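/- arXiv:1307.1978 — 2 statements merged into one kernel-verified Lean document; each statement's English description precedes it below -/
import Mathlib

section
/- Assume (φ₀,φ₁) ≢ 0 and let V be the smooth solution of problem (2.1) on ℝ×S¹×[0,τ₀) constructed by characteristics. Then for every b with 0 < b < τ₀ and all integers m, l ≥ 0 and multi-indices α, there are constants C^b_{m,α,l} and C^b_{α,l} such that for all (q,ω,τ) with 0 ≤ τ ≤ b: |∂_q^{m+1}∂_ω^α∂_τ^l V(q,ω,τ)| ≤ C^b_{m,α,l}(1+|q|)^{−3/2−m} and |∂_ω^α∂_τ^l V(q,ω,τ)| ≤ C^b_{α,l}. -/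
open Real MeasureTheory Filter Topology Asymptotics

noncomputable section

/-- Partial derivative in the `i`-th coordinate direction on `Fin 3 → ℝ`
(coordinates `y = (t, x₁, x₂)`). -/
def pd (i : Fin 3) (f : (Fin 3 → ℝ) → ℝ) : (Fin 3 → ℝ) → ℝ :=
  fun y => fderiv ℝ f y (Pi.single i 1)

/-- Radon transform of `v : ℝ² → ℝ` over the line `x · ω = s`, where
`ω = (cos θ, sin θ)`. -/
def radon (v : ℝ × ℝ → ℝ) (s θ : ℝ) : ℝ :=
  ∫ t : ℝ, v (s * Real.cos θ - t * Real.sin θ, s * Real.sin θ + t * Real.cos θ)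

/-- `ω̂ = (-1, cos θ, sin θ)`. -/
def omegaHat (θ : ℝ) : Fin 3 → ℝ := ![(-1 : ℝ), Real.cos θ, Real.sin θ]

/-- The Friedlander radiation field `F₀` associated with the data `(φ₀, φ₁)`. -/
def F0 (φ0 φ1 : ℝ × ℝ → ℝ) (σ θ : ℝ) : ℝ :=
  (1 / (2 * Real.pi * Real.sqrt 2)) *
    ∫ s in Set.Ioi σ,
      (radon φ1 s θ - deriv (fun s' => radon φ0 s' θ) s) / Real.sqrt (s - σ)

/-- `F₁(σ,θ) = (Σ d_ij ω̂_i ω̂_j) ∂_σ F₀(σ,θ)`. -/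
def F1 (d : Fin 3 → Fin 3 → ℝ) (φ0 φ1 : ℝ × ℝ → ℝ) (σ θ : ℝ) : ℝ :=
  (∑ i : Fin 3, ∑ j : Fin 3, d i j * omegaHat θ i * omegaHat θ j) *
    deriv (fun σ' => F0 φ0 φ1 σ' θ) σ

/-- `F₂(σ,θ) = (Σ e_ij^k ω̂_i ω̂_j ω̂_k) ∂²_σ F₀(σ,θ)`. -/
def F2 (e : Fin 3 → Fin 3 → Fin 3 → ℝ) (φ0 φ1 : ℝ × ℝ → ℝ) (σ θ : ℝ) : ℝ :=
  (∑ i : Fin 3, ∑ j : Fin 3, ∑ k : Fin 3,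
      e i j k * omegaHat θ i * omegaHat θ j * omegaHat θ k) *
    deriv (fun σ' => deriv (fun σ'' => F0 φ0 φ1 σ'' θ) σ') σ

/-- `G₀(σ,θ) = (1/F₁) log(1 + F₁/F₂)`. -/
def G0 (d : Fin 3 → Fin 3 → ℝ) (e : Fin 3 → Fin 3 → Fin 3 → ℝ)
    (φ0 φ1 : ℝ × ℝ → ℝ) (σ θ : ℝ) : ℝ :=
  (1 / F1 d φ0 φ1 σ θ) * Real.log (1 + F1 d φ0 φ1 σ θ / F2 e φ0 φ1 σ θ)

/-- The set `A`. -/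
def setA (M : ℝ) (d : Fin 3 → Fin 3 → ℝ) (e : Fin 3 → Fin 3 → Fin 3 → ℝ)
    (φ0 φ1 : ℝ × ℝ → ℝ) : Set (ℝ × ℝ) :=
  {p | p.1 < M ∧ p.2 ∈ Set.Icc 0 (2 * Real.pi) ∧
    F1 d φ0 φ1 p.1 p.2 ≠ 0 ∧ F2 e φ0 φ1 p.1 p.2 ≠ 0 ∧
    0 < 1 + F1 d φ0 φ1 p.1 p.2 / F2 e φ0 φ1 p.1 p.2}

/-- The set `B = {(σ,θ) ∈ A : G₀(σ,θ) > 0}`. -/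
def setB (M : ℝ) (d : Fin 3 → Fin 3 → ℝ) (e : Fin 3 → Fin 3 → Fin 3 → ℝ)
    (φ0 φ1 : ℝ × ℝ → ℝ) : Set (ℝ × ℝ) :=
  {p ∈ setA M d e φ0 φ1 | 0 < G0 d e φ0 φ1 p.1 p.2}

/-- `τ₀ = inf_{(σ,θ) ∈ B} G₀(σ,θ)`. -/
def tau0 (M : ℝ) (d : Fin 3 → Fin 3 → ℝ) (e : Fin 3 → Fin 3 → Fin 3 → ℝ)
    (φ0 φ1 : ℝ × ℝ → ℝ) : ℝ :=
  sInf ((fun p : ℝ × ℝ => G0 d e φ0 φ1 p.1 p.2) '' setB M d e φ0 φ1)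

/-- The set `D = {(σ,θ) : σ < M, F₁ = 0, F₂ > 0}`. -/
def setD (M : ℝ) (d : Fin 3 → Fin 3 → ℝ) (e : Fin 3 → Fin 3 → Fin 3 → ℝ)
    (φ0 φ1 : ℝ × ℝ → ℝ) : Set (ℝ × ℝ) :=
  {p | p.1 < M ∧ p.2 ∈ Set.Icc 0 (2 * Real.pi) ∧
    F1 d φ0 φ1 p.1 p.2 = 0 ∧ 0 < F2 e φ0 φ1 p.1 p.2}

/-- `φ` is supported in the closed disk of radius `M` centered at the origin. -/
def SuppIn (M : ℝ) (φ : ℝ × ℝ → ℝ) : Prop :=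
  ∀ x : ℝ × ℝ, M ^ 2 < x.1 ^ 2 + x.2 ^ 2 → φ x = 0

/-- The cubic form `Σ e_ij^k ξ_i ξ_j ξ_k` does not satisfy the null condition:
it does not vanish identically on the light cone. -/
def NullCondFails (e : Fin 3 → Fin 3 → Fin 3 → ℝ) : Prop :=
  ∃ ξ : Fin 3 → ℝ, ξ 0 ^ 2 = ξ 1 ^ 2 + ξ 2 ^ 2 ∧ (ξ 1 ≠ 0 ∨ ξ 2 ≠ 0) ∧
    (∑ i : Fin 3, ∑ j : Fin 3, ∑ k : Fin 3, e i j k * ξ i * ξ j * ξ k) ≠ 0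

/-- Hessian (as a 2×2 matrix) of a function of two real variables. -/
def hessCurried (f : ℝ → ℝ → ℝ) (σ θ : ℝ) : Matrix (Fin 2) (Fin 2) ℝ :=
  !![deriv (fun a => deriv (fun b => f b θ) a) σ,
     deriv (fun a => deriv (fun b => f a b) θ) σ;
     deriv (fun b => deriv (fun a => f a b) σ) θ,
     deriv (fun b => deriv (fun b' => f σ b') b) θ]

/-- Minkowski coefficients: `Σ c_ij ∂_ij = ∂_t² - Δ`. -/
def cMink : Fin 3 → Fin 3 → ℝ := fun i j =>
  if i = j then (if i = 0 then 1 else -1) else 0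

/-- `u` is a `C^∞` solution of problem (1.1) on `[0,T) × ℝ²`. -/
def IsSol (g : Fin 3 → Fin 3 → ℝ → (Fin 3 → ℝ) → ℝ) (ε : ℝ)
    (φ0 φ1 : ℝ × ℝ → ℝ) (u : (Fin 3 → ℝ) → ℝ) (T : ℝ) : Prop :=
  ContDiffOn ℝ (⊤ : ℕ∞) u {y | 0 ≤ y 0 ∧ y 0 < T} ∧
  (∀ y : Fin 3 → ℝ, 0 ≤ y 0 → y 0 < T →
    ∑ i : Fin 3, ∑ j : Fin 3,
      g i j (u y) (fun k => pd k u y) * pd i (pd j u) y = 0) ∧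
  (∀ x : ℝ × ℝ, u ![0, x.1, x.2] = ε * φ0 x ∧ pd 0 u ![0, x.1, x.2] = ε * φ1 x)

/-- The lifespan `T_ε`: the supremum of times of existence of smooth solutions. -/
def lifespan (g : Fin 3 → Fin 3 → ℝ → (Fin 3 → ℝ) → ℝ) (ε : ℝ)
    (φ0 φ1 : ℝ × ℝ → ℝ) : ℝ :=
  sSup {T : ℝ | ∃ u, IsSol g ε φ0 φ1 u T}

/-- `V` is a `C^∞` solution of the profile problem (2.1) on `ℝ × S¹ × [0, τmax)`. -/
def IsProfileSol (M : ℝ) (d : Fin 3 → Fin 3 → ℝ) (e : Fin 3 → Fin 3 → Fin 3 → ℝ)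
    (φ0 φ1 : ℝ × ℝ → ℝ) (τmax : ℝ) (V : ℝ → ℝ → ℝ → ℝ) : Prop :=
  ContDiffOn ℝ (⊤ : ℕ∞) (fun p : ℝ × ℝ × ℝ => V p.1 p.2.1 p.2.2)
    {p : ℝ × ℝ × ℝ | 0 ≤ p.2.2 ∧ p.2.2 < τmax} ∧
  (∀ q θ τ : ℝ, V q (θ + 2 * Real.pi) τ = V q θ τ) ∧
  (∀ q θ τ : ℝ, M < q → V q θ τ = 0) ∧
  (∀ q θ : ℝ, V q θ 0 = F0 φ0 φ1 q θ) ∧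
  (∀ q θ τ : ℝ, 0 ≤ τ → τ < τmax →
    deriv (fun τ' => deriv (fun q' => V q' θ τ') q) τ -
      ∑ i : Fin 3, ∑ j : Fin 3,
        (d i j * V q θ τ +
          ∑ k : Fin 3, e i j k * omegaHat θ k * deriv (fun q' => V q' θ τ) q) *
        omegaHat θ i * omegaHat θ j *
        deriv (fun q' => deriv (fun q'' => V q'' θ τ) q') q = 0)

/-- The Jacobian `∂_s q` of the characteristic flow. -/
def kfun (d : Fin 3 → Fin 3 → ℝ) (e : Fin 3 → Fin 3 → Fin 3 → ℝ)
    (φ0 φ1 : ℝ × ℝ → ℝ) (ρ θ τ : ℝ) : ℝ :=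
  if F1 d φ0 φ1 ρ θ = 0 then 1 - τ * F2 e φ0 φ1 ρ θ
  else Real.exp (-τ * F1 d φ0 φ1 ρ θ) * (1 + F2 e φ0 φ1 ρ θ / F1 d φ0 φ1 ρ θ)
        - F2 e φ0 φ1 ρ θ / F1 d φ0 φ1 ρ θ

/-- Partial derivatives on `ℝ × ℝ × ℝ` (coordinates `(s, θ, τ)`). -/
def pd3 : Fin 3 → (ℝ × ℝ × ℝ → ℝ) → ℝ × ℝ × ℝ → ℝ :=
  ![fun f p => deriv (fun a => f (a, p.2.1, p.2.2)) p.1,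
    fun f p => deriv (fun a => f (p.1, a, p.2.2)) p.2.1,
    fun f p => deriv (fun a => f (p.1, p.2.1, a)) p.2.2]

/-- Hessian in the first two variables `(s, θ)` of a function on `ℝ × ℝ × ℝ`. -/
def hessST (f : ℝ × ℝ × ℝ → ℝ) (p : ℝ × ℝ × ℝ) : Matrix (Fin 2) (Fin 2) ℝ :=
  !![pd3 0 (pd3 0 f) p, pd3 0 (pd3 1 f) p;
     pd3 1 (pd3 0 f) p, pd3 1 (pd3 1 f) p]

/-- The Klainerman vector fields on `ℝ_t × ℝ²`:
`∂_t, ∂_1, ∂_2, S = t∂_t + x₁∂_1 + x₂∂_2, H₁, H₂, R`. -/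
def KOp : Fin 7 → ((Fin 3 → ℝ) → ℝ) → (Fin 3 → ℝ) → ℝ :=
  ![fun f => pd 0 f,
    fun f => pd 1 f,
    fun f => pd 2 f,
    fun f y => y 0 * pd 0 f y + y 1 * pd 1 f y + y 2 * pd 2 f y,
    fun f y => y 1 * pd 0 f y + y 0 * pd 1 f y,
    fun f y => y 2 * pd 0 f y + y 0 * pd 2 f y,
    fun f y => y 1 * pd 2 f y - y 2 * pd 1 f y]

/-- `Z^α`: iterated product of Klainerman vector fields indexed by a list. -/
def Zpow (α : List (Fin 7)) (f : (Fin 3 → ℝ) → ℝ) : (Fin 3 → ℝ) → ℝ :=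
  α.foldr (fun i acc => KOp i acc) f

end

noncomputable section

/-- Mixed iterated partial derivative `∂_q^m ∂_θ^a ∂_τ^l V`. -/
def mderiv (m a l : ℕ) (V : ℝ → ℝ → ℝ → ℝ) (q θ τ : ℝ) : ℝ :=
  deriv^[m] (fun q' => deriv^[a] (fun θ' => deriv^[l] (fun τ' => V q' θ' τ') τ) θ) q

end

section

theorem pi_hasFDerivAt {E G : Type} [NormedAddCommGroup E] [NormedSpace ℝ E] [ProperSpace E]
    [NormedAddCommGroup G] [NormedSpace ℝ G] [CompleteSpace G] (F : E × ℝ → G)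
    (hF : ContDiff ℝ 1 F) (a b : ℝ) (x : E) :
    HasFDerivAt (fun x => ∫ s in a..b, F (x, s))
      (∫ s in a..b, (fderiv ℝ F (x, s)).comp (ContinuousLinearMap.inl ℝ E ℝ)) x := by
  have hc : Continuous F := hF.continuous
  have hfd : Continuous (fun p : E × ℝ => (fderiv ℝ F p).comp (ContinuousLinearMap.inl ℝ E ℝ)) :=
    (hF.continuous_fderiv one_ne_zero).clm_comp continuous_const
  obtain ⟨C, hC⟩ := ((isCompact_closedBall x 1).prod (isCompact_uIcc (a := a) (b := b))).exists_bound_of_continuousOn hfd.continuousOn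
  refine (intervalIntegral.hasFDerivAt_integral_of_dominated_of_fderiv_le (𝕜 := ℝ) (μ := volume)
    (F := fun x s => F (x, s)) (F' := fun x s => (fderiv ℝ F (x, s)).comp (ContinuousLinearMap.inl ℝ E ℝ))
    (bound := fun _ => C) (Metric.ball_mem_nhds x one_pos) ?_ ?_ ?_ ?_ ?_ ?_)
  · refine Eventually.of_forall fun y => ?_
    exact Continuous.aestronglyMeasurable (by fun_prop)
  · exact Continuous.intervalIntegrable (by fun_prop) _ _
  · exact (hfd.comp (by fun_prop : Continuous fun s : ℝ => (x, s))).aestronglyMeasurable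
  · refine Eventually.of_forall fun t ht y hy => ?_
    exact hC (y, t) ⟨Metric.ball_subset_closedBall hy, Set.uIoc_subset_uIcc ht⟩
  · exact intervalIntegrable_const
  · refine Eventually.of_forall fun t ht y hy => ?_
    have h1 : HasFDerivAt F (fderiv ℝ F (y, t)) (y, t) :=
      (hF.differentiable one_ne_zero _).hasFDerivAt
    have h2 : HasFDerivAt (fun y : E => (y, t)) (ContinuousLinearMap.inl ℝ E ℝ) y :=
      hasFDerivAt_prodMk_left y t
    exact h1.comp y h2

theorem pi_contDiff_nat {E : Type} [NormedAddCommGroup E] [NormedSpace ℝ E] [ProperSpace E]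
    (n : ℕ) : ∀ {G : Type} [NormedAddCommGroup G] [NormedSpace ℝ G] [CompleteSpace G] (F : E × ℝ → G)
    (_ : ContDiff ℝ (⊤ : ℕ∞) F) (a b : ℝ), ContDiff ℝ n (fun x => ∫ s in a..b, F (x, s)) := by
  induction n with
  | zero =>
    intro G _ _ _ F hF a b
    have hd : Differentiable ℝ (fun x => ∫ s in a..b, F (x, s)) := fun x =>
      (pi_hasFDerivAt F (hF.of_le (by exact_mod_cast le_top)) a b x).differentiableAt
    exact contDiff_zero.2 hd.continuous
  | succ n ih =>
    intro G _ _ _ F hF a b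
    have h1 := pi_hasFDerivAt F (hF.of_le (by exact_mod_cast le_top)) a b
    push_cast
    rw [contDiff_succ_iff_hasFDerivAt (n := (n : ℕ))]
    refine ⟨_, ?_, h1⟩
    refine ih (fun p : E × ℝ => (fderiv ℝ F p).comp (ContinuousLinearMap.inl ℝ E ℝ)) ?_ a b
    exact (hF.fderiv_right (by simp)).clm_comp contDiff_const

theorem pi_contDiff {E : Type} [NormedAddCommGroup E] [NormedSpace ℝ E] [ProperSpace E]
    {G : Type} [NormedAddCommGroup G] [NormedSpace ℝ G] [CompleteSpace G] (F : E × ℝ → G)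
    (hF : ContDiff ℝ (⊤ : ℕ∞) F) (a b : ℝ) :
    ContDiff ℝ (⊤ : ℕ∞) (fun x => ∫ s in a..b, F (x, s)) :=
  contDiff_infty.2 fun n => pi_contDiff_nat n F hF a b

/-- Smoothness of integrals with smooth integrand and smooth limits. -/
theorem pi_contDiff_var {E : Type} [NormedAddCommGroup E] [NormedSpace ℝ E] [ProperSpace E]
    (F : E × ℝ → ℝ) (hF : ContDiff ℝ (⊤ : ℕ∞) F) (a b : E → ℝ)
    (ha : ContDiff ℝ (⊤ : ℕ∞) a) (hb : ContDiff ℝ (⊤ : ℕ∞) b) :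
    ContDiff ℝ (⊤ : ℕ∞) (fun x => ∫ s in a x..b x, F (x, s)) := by
  have h : (fun x => ∫ s in a x..b x, F (x, s)) =
      fun x => ∫ u in (0:ℝ)..1, (b x - a x) * F (x, (b x - a x) * u + a x) := by
    funext x
    rw [intervalIntegral.integral_const_mul, intervalIntegral.mul_integral_comp_mul_add (f := fun s => F (x, s))]
    simp
  rw [h]
  refine pi_contDiff (fun p : E × ℝ => (b p.1 - a p.1) * F (p.1, (b p.1 - a p.1) * p.2 + a p.1)) ?_ 0 1
  have ha' : ContDiff ℝ (⊤ : ℕ∞) (fun p : E × ℝ => a p.1) := ha.comp contDiff_fst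
  have hb' : ContDiff ℝ (⊤ : ℕ∞) (fun p : E × ℝ => b p.1) := hb.comp contDiff_fst
  refine (hb'.sub ha').mul (hF.comp (contDiff_fst.prodMk (((hb'.sub ha').mul contDiff_snd).add ha')))

/-- derivative of a parametric integral along a real parameter -/
theorem pi_hasDerivAt (F : ℝ × ℝ → ℝ)
    (hF : ContDiff ℝ (⊤ : ℕ∞) F) (F' : ℝ → ℝ → ℝ) (a b : ℝ) (x : ℝ)
    (hF' : ∀ s, HasDerivAt (fun x => F (x, s)) (F' x s) x) :
    HasDerivAt (fun x => ∫ s in a..b, F (x, s)) (∫ s in a..b, F' x s) x := by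
  have h := (pi_hasFDerivAt F (hF.of_le (by exact_mod_cast le_top)) a b x).hasDerivAt
  suffices hE : (∫ s in a..b, F' x s) =
      (∫ s in a..b, (fderiv ℝ F (x, s)).comp (ContinuousLinearMap.inl ℝ ℝ ℝ)) 1 by
    rw [hE]; exact h
  have hfd : Continuous (fun p : ℝ × ℝ => (fderiv ℝ F p).comp (ContinuousLinearMap.inl ℝ ℝ ℝ)) :=
    ((hF.of_le (by exact_mod_cast le_top) : ContDiff ℝ 1 F).continuous_fderiv one_ne_zero).clm_comp continuous_const
  rw [ContinuousLinearMap.intervalIntegral_apply]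
  · refine intervalIntegral.integral_congr fun s _ => ?_
    have h1 : HasFDerivAt F (fderiv ℝ F (x, s)) (x, s) :=
      ((hF.differentiable (by simp)) _).hasFDerivAt
    have h2 : HasFDerivAt (fun y : ℝ => (y, s)) (ContinuousLinearMap.inl ℝ ℝ ℝ) x :=
      hasFDerivAt_prodMk_left x s
    have h3 := (h1.comp x h2).hasDerivAt
    exact (hF' s).unique h3
  · exact (hfd.comp (by fun_prop : Continuous fun s : ℝ => (x, s))).intervalIntegrable _ _

end

section

theorem radon_eq (M : ℝ) (φ : ℝ × ℝ → ℝ) (hM : 0 < M) (hs : SuppIn M φ) (s θ : ℝ) :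
    radon φ s θ = ∫ t in (-(M+1))..(M+1),
      φ (s * Real.cos θ - t * Real.sin θ, s * Real.sin θ + t * Real.cos θ) := by
  unfold radon
  symm
  apply intervalIntegral.integral_eq_integral_of_support_subset
  intro t ht
  by_contra hcon
  apply ht
  apply hs
  have : (s * Real.cos θ - t * Real.sin θ)^2 + (s * Real.sin θ + t * Real.cos θ)^2 = s^2 + t^2 := by
    have := Real.sin_sq_add_cos_sq θ
    linear_combination (s^2+t^2) * this
  simp only
  rw [this]
  simp only [Set.mem_Ioc, not_and_or, not_lt, not_le] at hcon
  rcases hcon with h | h <;> nlinarith [sq_nonneg s]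

theorem radon_smooth (M : ℝ) (φ : ℝ × ℝ → ℝ) (hM : 0 < M) (hs : SuppIn M φ)
    (hφ : ContDiff ℝ (⊤ : ℕ∞) φ) : ContDiff ℝ (⊤ : ℕ∞) (fun p : ℝ × ℝ => radon φ p.1 p.2) := by
  simp_rw [radon_eq M φ hM hs]
  refine pi_contDiff (fun p : (ℝ × ℝ) × ℝ => φ (p.1.1 * Real.cos p.1.2 - p.2 * Real.sin p.1.2,
    p.1.1 * Real.sin p.1.2 + p.2 * Real.cos p.1.2)) ?_ _ _
  refine hφ.comp ?_
  fun_prop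

theorem radon_zero (M : ℝ) (φ : ℝ × ℝ → ℝ) (hM : 0 < M) (hs : SuppIn M φ) (s θ : ℝ)
    (h : M < |s|) : radon φ s θ = 0 := by
  unfold radon
  have : ∀ t : ℝ, φ (s * Real.cos θ - t * Real.sin θ, s * Real.sin θ + t * Real.cos θ) = 0 := by
    intro t
    apply hs
    have : (s * Real.cos θ - t * Real.sin θ)^2 + (s * Real.sin θ + t * Real.cos θ)^2 = s^2 + t^2 := by
      have := Real.sin_sq_add_cos_sq θ
      linear_combination (s^2+t^2) * this
    simp only
    rw [this]
    have := sq_abs s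
    nlinarith [sq_nonneg t]
  simp [this]

/-- partial derivative in first variable is smooth -/
theorem smooth_pd1 {f : ℝ × ℝ → ℝ} (hf : ContDiff ℝ (⊤ : ℕ∞) f) :
    ContDiff ℝ (⊤ : ℕ∞) (fun p : ℝ × ℝ => deriv (fun s => f (s, p.2)) p.1) := by
  have : (fun p : ℝ × ℝ => deriv (fun s => f (s, p.2)) p.1) = fun p => fderiv ℝ f p (1, 0) := by
    funext p
    have h1 : HasFDerivAt f (fderiv ℝ f (p.1, p.2)) (p.1, p.2) :=
      (hf.differentiable (by simp) _).hasFDerivAt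
    have h3 := (h1.comp p.1 (hasFDerivAt_prodMk_left p.1 p.2)).hasDerivAt.deriv
    simpa [Function.comp_def] using h3
  rw [this]
  exact (hf.fderiv_right (by simp)).clm_apply contDiff_const

theorem F0_compact (M : ℝ) (hM : 0 < M) (φ0 φ1 : ℝ × ℝ → ℝ)
    (hφ0 : ContDiff ℝ (⊤ : ℕ∞) φ0) (hφ1 : ContDiff ℝ (⊤ : ℕ∞) φ1)
    (hs0 : SuppIn M φ0) (hs1 : SuppIn M φ1) :
    ∃ f : ℝ × ℝ → ℝ, ContDiff ℝ (⊤ : ℕ∞) f ∧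
      ∀ ρ θ : ℝ, 0 < ρ → F0 φ0 φ1 (-2 * M - (ρ ^ 2)⁻¹) θ = f (ρ, θ) := by
  set H : ℝ × ℝ → ℝ := fun p => radon φ1 p.1 p.2 - deriv (fun s' => radon φ0 s' p.2) p.1 with hH
  have hHs : ContDiff ℝ (⊤ : ℕ∞) H :=
    (radon_smooth M φ1 hM hs1 hφ1).sub (smooth_pd1 (radon_smooth M φ0 hM hs0 hφ0))
  have hH0 : ∀ s θ, M < |s| → H (s, θ) = 0 := by
    intro s θ h
    have : (fun s' => radon φ0 s' θ) =ᶠ[𝓝 s] fun _ => 0 := by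
      filter_upwards [(isOpen_lt continuous_const continuous_abs).mem_nhds h] with s' hs'
      exact radon_zero M φ0 hM hs0 s' θ hs'
    simp only [hH]
    rw [radon_zero M φ1 hM hs1 s θ h, this.deriv_eq]
    simp
  set g : (ℝ × ℝ) × ℝ → ℝ := fun p => H (p.2, p.1.2) * (p.1.1 * (Real.sqrt (1 + (p.2 + 2 * M) * p.1.1 ^ 2))⁻¹) with hg
  have hgs : ContDiff ℝ (⊤ : ℕ∞) g := by
    rw [contDiff_iff_contDiffAt]
    rintro ⟨⟨ρ, θ⟩, s⟩
    by_cases h : s < - M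
    · have : g =ᶠ[𝓝 ((ρ, θ), s)] fun _ => 0 := by
        have ho : IsOpen {p : (ℝ × ℝ) × ℝ | p.2 < -M} := isOpen_lt continuous_snd continuous_const
        filter_upwards [ho.mem_nhds h] with p hp
        simp only [hg]
        rw [hH0, zero_mul]
        have hp : p.2 < -M := hp
        rw [abs_of_neg (by linarith)]
        linarith
      exact contDiffAt_const.congr_of_eventuallyEq this
    · have hpos : 0 < 1 + (s + 2 * M) * ρ ^ 2 := by
        have : 0 ≤ (s + 2 * M) * ρ^2 := mul_nonneg (by linarith) (sq_nonneg _)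
        linarith
      have hin : ContDiffAt ℝ (⊤ : ℕ∞) (fun p : (ℝ × ℝ) × ℝ => 1 + (p.2 + 2 * M) * p.1.1 ^ 2) ((ρ, θ), s) := by
        fun_prop
      refine ContDiffAt.mul ?_ (ContDiffAt.mul ?_ (ContDiffAt.inv (hin.sqrt hpos.ne') ?_))
      · exact (hHs.comp (by fun_prop : ContDiff ℝ (⊤ : ℕ∞) fun p : (ℝ × ℝ) × ℝ => (p.2, p.1.2))).contDiffAt
      · fun_prop
      · exact (Real.sqrt_pos.2 hpos).ne'
  refine ⟨fun p => (1 / (2 * Real.pi * Real.sqrt 2)) * ∫ s in (-(2*M))..(2*M), g (p, s),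
    contDiff_const.mul (pi_contDiff g hgs _ _), ?_⟩
  intro ρ θ hρ
  unfold F0
  congr 1
  set σ := -2 * M - (ρ ^ 2)⁻¹ with hσ
  have hr : 0 < (ρ ^ 2)⁻¹ := by positivity
  have key : ∀ s, (radon φ1 s θ - deriv (fun s' => radon φ0 s' θ) s) / Real.sqrt (s - σ) = g ((ρ, θ), s) := by
    intro s
    change H (s, θ) / _ = _
    by_cases h : M < |s|
    · simp [hg, hH0 s θ h]
    · have hsM := abs_le.1 (not_lt.1 h)
      simp only [hg, div_eq_mul_inv]
      congr 1
      have e1 : s - σ = (ρ⁻¹) ^ 2 * (1 + (s + 2 * M) * ρ ^ 2) := by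
        rw [hσ]; field_simp; ring
      rw [e1, Real.sqrt_mul (by positivity), Real.sqrt_sq (by positivity)]
      rw [mul_inv, inv_inv]
  simp_rw [key]
  rw [setIntegral_eq_integral_of_forall_compl_eq_zero, intervalIntegral.integral_eq_integral_of_support_subset]
  · intro s hs
    by_contra hcon
    apply hs
    simp only [hg]
    rw [hH0, zero_mul]
    simp only [Set.mem_Ioc, not_and_or, not_lt, not_le] at hcon
    rcases hcon with h | h
    · rw [abs_of_neg (by linarith)]; linarith
    · rw [abs_of_pos (by linarith)]; linarith
  · intro s hs
    simp only [hg]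
    rw [hH0, zero_mul]
    simp only [Set.mem_Ioi, not_lt] at hs
    rw [abs_of_neg (by linarith)]; linarith

end

section

/-- `∫_0^τ exp(-u x) du` -/
noncomputable def JJ (x τ : ℝ) : ℝ := ∫ u in (0:ℝ)..τ, Real.exp (-(u * x))

theorem JJ_smooth : ContDiff ℝ (⊤ : ℕ∞) (fun p : ℝ × ℝ => JJ p.1 p.2) := by
  unfold JJ
  refine pi_contDiff_var (fun p : (ℝ × ℝ) × ℝ => Real.exp (-(p.2 * p.1.1))) ?_ (fun _ => 0) (fun p => p.2)
    contDiff_const contDiff_snd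
  fun_prop

theorem JJ_zero (x : ℝ) : JJ x 0 = 0 := by simp [JJ]

theorem JJ_deriv (x τ : ℝ) : HasDerivAt (fun t => JJ x t) (Real.exp (-(τ * x))) τ := by
  unfold JJ
  have hc : Continuous (fun u : ℝ => Real.exp (-(u * x))) := by fun_prop
  exact intervalIntegral.integral_hasDerivAt_right (hc.intervalIntegrable _ _)
    (hc.stronglyMeasurableAtFilter _ _) hc.continuousAt

theorem JJ_mul (x τ : ℝ) : x * JJ x τ = 1 - Real.exp (-(τ * x)) := by
  unfold JJ
  rw [← intervalIntegral.integral_const_mul]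
  have h : ∀ u ∈ Set.uIcc 0 τ, HasDerivAt (fun u => - Real.exp (-(u * x))) (x * Real.exp (-(u * x))) u := by
    intro u _
    have h1 : HasDerivAt (fun u : ℝ => -(u * x)) (-(1 * x)) u := ((hasDerivAt_id u).mul_const x).neg
    refine HasDerivAt.congr_deriv (h1.exp.neg) ?_
    ring
  rw [intervalIntegral.integral_eq_sub_of_hasDerivAt h (Continuous.intervalIntegrable (by fun_prop) _ _)]
  simp
  ring

theorem gron_step (f f' : ℝ → ℝ) (t K l : ℝ) (ht : 0 ≤ t) (hc : ContinuousOn f (Set.Icc 0 t))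
    (hd : ∀ u ∈ Set.Ioo 0 t, HasDerivAt f (f' u) u)
    (hb : ∀ u ∈ Set.Ioo 0 t, |f' u| ≤ K * (l * Real.exp (l * u))) (h0 : f 0 = 0) :
    |f t| ≤ K * Real.exp (l * t) - K := by
  have hE : ∀ u, HasDerivAt (fun u => K * Real.exp (l * u)) (K * (l * Real.exp (l * u))) u := by
    intro u
    have h1 : HasDerivAt (fun u : ℝ => l * u) (l * 1) u := (hasDerivAt_id u).const_mul l
    refine HasDerivAt.congr_deriv (h1.exp.const_mul K) ?_
    ring
  have hEc : Continuous (fun u => K * Real.exp (l * u)) := by fun_prop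
  have main : ∀ σ : ℝ, |σ| = 1 → σ * f t ≤ K * Real.exp (l * t) - K := by
    intro σ hσ
    have hm : MonotoneOn (fun u => K * Real.exp (l * u) - σ * f u) (Set.Icc 0 t) := by
      have hd2 : ∀ u ∈ Set.Ioo 0 t, HasDerivAt (fun u => K * Real.exp (l * u) - σ * f u)
          (K * (l * Real.exp (l * u)) - σ * f' u) u := fun u hu => (hE u).sub ((hd u hu).const_mul σ)
      refine monotoneOn_of_deriv_nonneg (convex_Icc 0 t) (hEc.continuousOn.sub (hc.const_mul σ)) ?_ ?_
      · rw [interior_Icc]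
        exact fun u hu => (hd2 u hu).differentiableAt.differentiableWithinAt
      · rw [interior_Icc]
        intro u hu
        rw [(hd2 u hu).deriv]
        have : σ * f' u ≤ |f' u| := by
          calc σ * f' u ≤ |σ * f' u| := le_abs_self _
            _ = |f' u| := by rw [abs_mul, hσ, one_mul]
        linarith [hb u hu]
    have := hm (Set.left_mem_Icc.2 ht) (Set.right_mem_Icc.2 ht) ht
    simp [h0] at this
    linarith
  rw [abs_le]
  have h1 := main 1 (by simp)
  have h2 := main (-1) (by simp)
  constructor <;> linarith

/-- Jacobian of the characteristic flow, fixed angle. -/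
noncomputable def kk (d e : ℝ) (w0 w1 : ℝ → ℝ) (s τ : ℝ) : ℝ :=
  1 - (d * w0 s + e * w1 s) * JJ (d * w0 s) τ

noncomputable def QQ (M d e : ℝ) (w0 w1 : ℝ → ℝ) (s τ : ℝ) : ℝ :=
  M - ∫ s' in s..M, kk d e w0 w1 s' τ

theorem kk_smooth (d e : ℝ) (w0 w1 : ℝ → ℝ) (h0 : ContDiff ℝ (⊤ : ℕ∞) w0) (h1 : ContDiff ℝ (⊤ : ℕ∞) w1) :
    ContDiff ℝ (⊤ : ℕ∞) (fun p : ℝ × ℝ => kk d e w0 w1 p.1 p.2) := by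
  unfold kk
  have h0' : ContDiff ℝ (⊤ : ℕ∞) (fun p : ℝ × ℝ => w0 p.1) := h0.comp contDiff_fst
  have h1' : ContDiff ℝ (⊤ : ℕ∞) (fun p : ℝ × ℝ => w1 p.1) := h1.comp contDiff_fst
  have hJ : ContDiff ℝ (⊤ : ℕ∞) (fun p : ℝ × ℝ => JJ (d * w0 p.1) p.2) :=
    JJ_smooth.comp ((contDiff_const.mul h0').prodMk contDiff_snd)
  exact contDiff_const.sub (((contDiff_const.mul h0').add (contDiff_const.mul h1')).mul hJ)

theorem QQ_deriv_s (M d e : ℝ) (w0 w1 : ℝ → ℝ) (h0 : ContDiff ℝ (⊤ : ℕ∞) w0) (h1 : ContDiff ℝ (⊤ : ℕ∞) w1)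
    (s τ : ℝ) : HasDerivAt (fun s => QQ M d e w0 w1 s τ) (kk d e w0 w1 s τ) s := by
  unfold QQ
  have hc : Continuous (fun s => kk d e w0 w1 s τ) :=
    (kk_smooth d e w0 w1 h0 h1).continuous.comp (by fun_prop : Continuous fun s : ℝ => (s, τ))
  have := (intervalIntegral.integral_hasDerivAt_left (hc.intervalIntegrable s M)
    (hc.stronglyMeasurableAtFilter _ _) hc.continuousAt).const_sub M
  simpa using this

theorem QQ_cont (M d e : ℝ) (w0 w1 : ℝ → ℝ) (h0 : ContDiff ℝ (⊤ : ℕ∞) w0) (h1 : ContDiff ℝ (⊤ : ℕ∞) w1) :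
    Continuous (fun p : ℝ × ℝ => QQ M d e w0 w1 p.1 p.2) := by
  unfold QQ
  have h := kk_smooth d e w0 w1 h0 h1
  have := pi_contDiff_var (E := ℝ × ℝ) (fun p => kk d e w0 w1 p.2 p.1.2)
    (h.comp (by fun_prop : ContDiff ℝ (⊤ : ℕ∞) fun p : (ℝ × ℝ) × ℝ => (p.2, p.1.2))) (fun p => p.1) (fun _ => M)
    contDiff_fst contDiff_const
  exact continuous_const.sub this.continuous

theorem QQ_deriv_tau (M d e : ℝ) (w0 w1 : ℝ → ℝ) (h0 : ContDiff ℝ (⊤ : ℕ∞) w0) (h1 : ContDiff ℝ (⊤ : ℕ∞) w1)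
    (hw : ∀ s, HasDerivAt w0 (w1 s) s) (hM : w0 M = 0)
    (s τ : ℝ) : HasDerivAt (fun τ => QQ M d e w0 w1 s τ)
      (d * (∫ s' in s..M, w0 s' * kk d e w0 w1 s' τ) - e * w0 s) τ := by
  have hk := kk_smooth d e w0 w1 h0 h1
  have hkt : ∀ s', HasDerivAt (fun t => kk d e w0 w1 s' t)
      (-(d * (w0 s' * kk d e w0 w1 s' τ) + e * w1 s')) τ := by
    intro s'
    unfold kk
    refine HasDerivAt.congr_deriv (((JJ_deriv (d * w0 s') τ).const_mul (d * w0 s' + e * w1 s')).const_sub 1) ?_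
    linear_combination -(d * w0 s' + e * w1 s') * JJ_mul (d * w0 s') τ
  have := pi_hasDerivAt (fun p : ℝ × ℝ => kk d e w0 w1 p.2 p.1)
    (hk.comp (by fun_prop : ContDiff ℝ (⊤ : ℕ∞) fun p : ℝ × ℝ => (p.2, p.1)))
    (fun t s' => -(d * (w0 s' * kk d e w0 w1 s' t) + e * w1 s')) s M τ hkt
  unfold QQ
  refine HasDerivAt.congr_deriv (this.const_sub M) ?_
  have hc : Continuous (fun s => kk d e w0 w1 s τ) :=
    hk.continuous.comp (by fun_prop : Continuous fun s : ℝ => (s, τ))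
  have hc0 := h0.continuous
  have hc1 := h1.continuous
  rw [intervalIntegral.integral_neg, intervalIntegral.integral_add
    (Continuous.intervalIntegrable (by fun_prop) _ _) (Continuous.intervalIntegrable (by fun_prop) _ _),
    intervalIntegral.integral_const_mul, intervalIntegral.integral_const_mul,
    intervalIntegral.integral_eq_sub_of_hasDerivAt (fun u _ => hw u) (hc1.intervalIntegrable _ _), hM]
  ring

theorem char_identity (T M d e : ℝ) (V W Wq Wt : ℝ → ℝ → ℝ) (w0 w1 : ℝ → ℝ)
    (h0 : ContDiff ℝ (⊤ : ℕ∞) w0) (h1 : ContDiff ℝ (⊤ : ℕ∞) w1)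
    (hw : ∀ s, HasDerivAt w0 (w1 s) s) (hM : w0 M = 0)
    (hV : ∀ q τ, 0 ≤ τ → τ < T → HasDerivAt (fun q => V q τ) (W q τ) q)
    (hWc : ContinuousOn (fun p : ℝ × ℝ => W p.1 p.2) {p | 0 ≤ p.2 ∧ p.2 < T})
    (hWqc : ContinuousOn (fun p : ℝ × ℝ => Wq p.1 p.2) {p | 0 ≤ p.2 ∧ p.2 < T})
    (hW : ∀ (q : ℝ → ℝ) (q' τ : ℝ), 0 < τ → τ < T → HasDerivAt q q' τ →
      HasDerivAt (fun t => W (q t) t) (Wq (q τ) τ * q' + Wt (q τ) τ) τ)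
    (hpde : ∀ q τ, 0 < τ → τ < T → Wt q τ = (d * V q τ + e * W q τ) * Wq q τ)
    (hVM : ∀ τ, 0 ≤ τ → τ < T → V M τ = 0)
    (hinit : ∀ q, W q 0 = w0 q) (s τ : ℝ) (hs : s ≤ M) (hτ : 0 ≤ τ) (hτT : τ < T) :
    W (QQ M d e w0 w1 s τ) τ = w0 s := by
  set k := kk d e w0 w1 with hk
  set Q := QQ M d e w0 w1 with hQ
  have hkc : Continuous (fun p : ℝ × ℝ => k p.1 p.2) := (kk_smooth d e w0 w1 h0 h1).continuous
  have hQc : Continuous (fun p : ℝ × ℝ => Q p.1 p.2) := QQ_cont M d e w0 w1 h0 h1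
  have hQ0 : ∀ s, Q s 0 = s := by
    intro s
    simp [hQ, QQ, kk, JJ_zero]
  have hQM : ∀ t, Q M t = M := by intro t; simp [hQ, QQ]
  have hWQc : ContinuousOn (fun p : ℝ × ℝ => W (Q p.1 p.2) p.2) {p | 0 ≤ p.2 ∧ p.2 < T} :=
    hWc.comp (f := fun p : ℝ × ℝ => (Q p.1 p.2, p.2)) (by fun_prop) (fun p hp => hp)
  have hWqQc : ContinuousOn (fun p : ℝ × ℝ => Wq (Q p.1 p.2) p.2) {p | 0 ≤ p.2 ∧ p.2 < T} :=
    hWqc.comp (f := fun p : ℝ × ℝ => (Q p.1 p.2, p.2)) (by fun_prop) (fun p hp => hp)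
  have hc0 : Continuous w0 := h0.continuous
  have hWQs : ∀ t, 0 ≤ t → t < T → Continuous (fun s => W (Q s t) t) := by
    intro t ht0 htT
    have := hWQc.comp_continuous (f := fun s : ℝ => (s, t)) (by fun_prop) (fun s => ⟨ht0, htT⟩)
    exact this
  have hks : ∀ t, Continuous (fun s => k s t) := fun t =>
    hkc.comp (by fun_prop : Continuous fun s : ℝ => (s, t))
  -- integral formula for V along the flow
  have hVQ : ∀ s t, 0 ≤ t → t < T → V (Q s t) t = - ∫ s' in s..M, W (Q s' t) t * k s' t := by
    intro s t ht0 htT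
    have hd : ∀ u ∈ Set.uIcc s M, HasDerivAt (fun s => V (Q s t) t) (W (Q u t) t * k u t) u := by
      intro u _
      exact (hV (Q u t) t ht0 htT).comp u (QQ_deriv_s M d e w0 w1 h0 h1 u t)
    rw [intervalIntegral.integral_eq_sub_of_hasDerivAt hd
      (((hWQs t ht0 htT).mul (hks t)).intervalIntegrable _ _), hQM, hVM t ht0 htT]
    ring
  set y : ℝ → ℝ → ℝ := fun s t => W (Q s t) t - w0 s with hy
  have hyc : ContinuousOn (fun p : ℝ × ℝ => y p.1 p.2) {p | 0 ≤ p.2 ∧ p.2 < T} :=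
    hWQc.sub (by fun_prop)
  have hyd : ∀ s t, 0 < t → t < T → HasDerivAt (fun t => y s t)
      (Wq (Q s t) t * (e * y s t - d * ∫ s' in s..M, y s' t * k s' t)) t := by
    intro s t ht0 htT
    have h := (hW (fun t => Q s t) _ t ht0 htT (QQ_deriv_tau M d e w0 w1 h0 h1 hw hM s t)).sub_const (w0 s)
    refine HasDerivAt.congr_deriv (h) ?_
    rw [hpde _ _ ht0 htT, hVQ s t ht0.le htT]
    simp only [hy]
    have : (∫ s' in s..M, (W (Q s' t) t - w0 s') * k s' t) =
        (∫ s' in s..M, W (Q s' t) t * k s' t) - ∫ s' in s..M, w0 s' * k s' t := by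
      have i1 : IntervalIntegrable (fun s' => W (Q s' t) t * k s' t) volume s M :=
        ((hWQs t ht0.le htT).mul (hks t)).intervalIntegrable _ _
      have i2 : IntervalIntegrable (fun s' => w0 s' * k s' t) volume s M :=
        (hc0.mul (hks t)).intervalIntegrable _ _
      rw [← intervalIntegral.integral_sub i1 i2]
      refine intervalIntegral.integral_congr fun u _ => ?_
      ring
    rw [this]
    ring
  -- Gronwall on the compact set
  set K : Set (ℝ × ℝ) := Set.Icc s M ×ˢ Set.Icc 0 τ with hK
  have hKc : IsCompact K := isCompact_Icc.prod isCompact_Icc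
  have hKsub : K ⊆ {p | 0 ≤ p.2 ∧ p.2 < T} := fun p hp => ⟨hp.2.1, hp.2.2.trans_lt hτT⟩
  obtain ⟨C1, hC1⟩ := hKc.exists_bound_of_continuousOn (hWqQc.mono hKsub)
  obtain ⟨C2, hC2⟩ := hKc.exists_bound_of_continuousOn (hkc.continuousOn (s := K))
  have hne : K.Nonempty := ⟨(s, 0), ⟨⟨le_rfl, hs⟩, ⟨le_rfl, hτ⟩⟩⟩
  have hC1n : 0 ≤ C1 := (norm_nonneg _).trans (hC1 _ hne.some_mem)
  have hC2n : 0 ≤ C2 := (norm_nonneg _).trans (hC2 _ hne.some_mem)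
  set C := C1 * (|e| + |d| * (C2 * (M - s))) + 1 with hC
  have hMs : 0 ≤ M - s := by linarith
  have hCpos : 0 < C := by positivity
  set l := 2 * C with hl
  have hzc : ContinuousOn (fun p : ℝ × ℝ => |y p.1 p.2| * Real.exp (-(l * p.2))) K :=
    ((hyc.mono hKsub).abs).mul (by fun_prop)
  obtain ⟨p, hpK, hpmax⟩ := hKc.exists_isMaxOn hne hzc
  set S := |y p.1 p.2| * Real.exp (-(l * p.2)) with hS
  have hbd : ∀ u ∈ Set.Icc s M, ∀ t ∈ Set.Icc 0 τ, |y u t| ≤ S * Real.exp (l * t) := by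
    intro u hu t ht
    have := hpmax (show (u, t) ∈ K from ⟨hu, ht⟩)
    have h2 : |y u t| * Real.exp (-(l * t)) ≤ S := this
    calc |y u t| = |y u t| * Real.exp (-(l * t)) * Real.exp (l * t) := by
          rw [mul_assoc, ← Real.exp_add]; simp
      _ ≤ _ := by gcongr
  have hSn : 0 ≤ S := by positivity
  have hder : ∀ u ∈ Set.Icc s M, ∀ t ∈ Set.Ioo 0 τ,
      |Wq (Q u t) t * (e * y u t - d * ∫ s' in u..M, y s' t * k s' t)| ≤ (S / 2) * (l * Real.exp (l * t)) := by
    intro u hu t ht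
    have ht' : t ∈ Set.Icc 0 τ := ⟨ht.1.le, ht.2.le⟩
    have a1 : |Wq (Q u t) t| ≤ C1 := hC1 (u, t) ⟨hu, ht'⟩
    have a2 := hbd u hu t ht'
    have a3 : ‖∫ s' in u..M, y s' t * k s' t‖ ≤ (S * Real.exp (l * t) * C2) * |M - u| := by
      refine intervalIntegral.norm_integral_le_of_norm_le_const ?_
      intro v hv
      rw [Set.uIoc_of_le hu.2] at hv
      have hv' : v ∈ Set.Icc s M := ⟨hu.1.trans hv.1.le, hv.2⟩
      rw [norm_mul]
      exact mul_le_mul (hbd v hv' t ht') (hC2 (v, t) ⟨hv', ht'⟩) (norm_nonneg _) (by positivity)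
    have a4 : |M - u| ≤ M - s := by rw [abs_of_nonneg (by linarith [hu.2])]; linarith [hu.1]
    have a5 : |e * y u t - d * ∫ s' in u..M, y s' t * k s' t| ≤
        |e| * (S * Real.exp (l * t)) + |d| * ((S * Real.exp (l * t) * C2) * (M - s)) := by
      calc _ ≤ |e * y u t| + |d * ∫ s' in u..M, y s' t * k s' t| := abs_sub _ _
        _ = |e| * |y u t| + |d| * |∫ s' in u..M, y s' t * k s' t| := by rw [abs_mul, abs_mul]
        _ ≤ _ := by
          gcongr
          refine a3.trans ?_
          gcongr
    rw [abs_mul]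
    calc _ ≤ C1 * (|e| * (S * Real.exp (l * t)) + |d| * ((S * Real.exp (l * t) * C2) * (M - s))) := by
          gcongr
      _ = (C - 1) * (S * Real.exp (l * t)) := by rw [hC]; ring
      _ ≤ C * (S * Real.exp (l * t)) := by gcongr; linarith
      _ = _ := by rw [hl]; ring
  have hfin : ∀ u ∈ Set.Icc s M, ∀ t ∈ Set.Icc 0 τ, |y u t| ≤ (S / 2) * Real.exp (l * t) := by
    intro u hu t ht
    have := gron_step (fun t => y u t) _ t (S / 2) l ht.1 ?_ (fun v hv => hyd u v hv.1 ((hv.2.trans_le ht.2).trans hτT))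
      (fun v hv => hder u hu v ⟨hv.1, hv.2.trans_le ht.2⟩) ?_
    · linarith
    · exact hyc.comp (f := fun t : ℝ => (u, t)) (by fun_prop) (fun v hv => ⟨hv.1, (hv.2.trans ht.2).trans_lt hτT⟩)
    · simp [hy, hQ0, hinit]
  have hS0 : S ≤ S / 2 := by
    have := hfin p.1 hpK.1 p.2 hpK.2
    calc S ≤ (S / 2) * Real.exp (l * p.2) * Real.exp (-(l * p.2)) := by
          conv_lhs => rw [hS]
          gcongr
      _ = S / 2 := by rw [mul_assoc, ← Real.exp_add]; simp
  have hS00 : S = 0 := by linarith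
  have := hbd s ⟨le_rfl, hs⟩ τ ⟨hτ, le_rfl⟩
  rw [hS00, zero_mul] at this
  have := abs_nonpos_iff.1 this
  simp only [hy] at this
  linarith

theorem char_V (T M d e : ℝ) (V W : ℝ → ℝ → ℝ) (w0 w1 : ℝ → ℝ)
    (h0 : ContDiff ℝ (⊤ : ℕ∞) w0) (h1 : ContDiff ℝ (⊤ : ℕ∞) w1)
    (hV : ∀ q τ, 0 ≤ τ → τ < T → HasDerivAt (fun q => V q τ) (W q τ) q)
    (hVM : ∀ τ, 0 ≤ τ → τ < T → V M τ = 0) (s τ : ℝ) (hs : s ≤ M) (hτ : 0 ≤ τ) (hτT : τ < T)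
    (hid : ∀ s, s ≤ M → W (QQ M d e w0 w1 s τ) τ = w0 s) :
    V (QQ M d e w0 w1 s τ) τ = - ∫ s' in s..M, w0 s' * kk d e w0 w1 s' τ := by
  have hd : ∀ u ∈ Set.uIcc s M, HasDerivAt (fun s => V (QQ M d e w0 w1 s τ) τ)
      (w0 u * kk d e w0 w1 u τ) u := by
    intro u hu
    rw [Set.uIcc_of_le hs] at hu
    rw [← hid u hu.2]
    exact (hV (QQ M d e w0 w1 u τ) τ hτ hτT).comp u (QQ_deriv_s M d e w0 w1 h0 h1 u τ)
  have hc : Continuous (fun s => kk d e w0 w1 s τ) :=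
    (kk_smooth d e w0 w1 h0 h1).continuous.comp (by fun_prop : Continuous fun s : ℝ => (s, τ))
  rw [intervalIntegral.integral_eq_sub_of_hasDerivAt hd ((h0.continuous.mul hc).intervalIntegrable _ _)]
  have : QQ M d e w0 w1 M τ = M := by simp [QQ]
  rw [this, hVM τ hτ hτT]
  ring

end

section

/-- The closed-open slab `0 ≤ τ < T`. -/
def slab (T : ℝ) : Set (ℝ × ℝ × ℝ) := {p : ℝ × ℝ × ℝ | 0 ≤ p.2.2 ∧ p.2.2 < T}

/-- Directional derivative within the slab. -/
noncomputable def DW (T : ℝ) (v : ℝ × ℝ × ℝ) (f : ℝ × ℝ × ℝ → ℝ) (p : ℝ × ℝ × ℝ) : ℝ :=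
  fderivWithin ℝ f (slab T) p v

theorem slab_unique (T : ℝ) : UniqueDiffOn ℝ (slab T) := by
  have : slab T = Set.univ ×ˢ (Set.univ ×ˢ Set.Ico 0 T) := by
    ext p; simp [slab]
  rw [this]
  exact uniqueDiffOn_univ.prod (uniqueDiffOn_univ.prod (uniqueDiffOn_Ico 0 T))

theorem DW_smooth {T : ℝ} {f : ℝ × ℝ × ℝ → ℝ} (v : ℝ × ℝ × ℝ) (hf : ContDiffOn ℝ (⊤ : ℕ∞) f (slab T)) :
    ContDiffOn ℝ (⊤ : ℕ∞) (DW T v f) (slab T) :=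
  (hf.fderivWithin (slab_unique T) (by simp)).clm_apply contDiffOn_const

theorem DW_iter_smooth {T : ℝ} {f : ℝ × ℝ × ℝ → ℝ} (v : ℝ × ℝ × ℝ) (hf : ContDiffOn ℝ (⊤ : ℕ∞) f (slab T))
    (n : ℕ) : ContDiffOn ℝ (⊤ : ℕ∞) ((DW T v)^[n] f) (slab T) := by
  induction n with
  | zero => exact hf
  | succ n ih => rw [Function.iterate_succ_apply']; exact DW_smooth v ih

theorem DW_curve {T : ℝ} {f : ℝ × ℝ × ℝ → ℝ} (hf : ContDiffOn ℝ (⊤ : ℕ∞) f (slab T))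
    {A : Set ℝ} {t a b c : ℝ} {x y z : ℝ → ℝ} (ht : t ∈ A) (hA : ∀ t ∈ A, 0 ≤ z t ∧ z t < T)
    (hx : HasDerivWithinAt x a A t) (hy : HasDerivWithinAt y b A t) (hz : HasDerivWithinAt z c A t) :
    HasDerivWithinAt (fun t => f (x t, y t, z t))
      (a * DW T (1, 0, 0) f (x t, y t, z t) + b * DW T (0, 1, 0) f (x t, y t, z t)
        + c * DW T (0, 0, 1) f (x t, y t, z t)) A t := by
  have hmem : (x t, y t, z t) ∈ slab T := hA t ht
  have h1 : HasFDerivWithinAt f (fderivWithin ℝ f (slab T) (x t, y t, z t)) (slab T) (x t, y t, z t) :=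
    ((hf.differentiableOn (by simp)) _ hmem).hasFDerivWithinAt
  have h2 : HasDerivWithinAt (fun t => (x t, y t, z t)) (a, b, c) A t := hx.prodMk (hy.prodMk hz)
  have h3 := h1.comp_hasDerivWithinAt t h2 (fun u hu => hA u hu)
  refine HasDerivWithinAt.congr_deriv h3 ?_
  have : ((a, b, c) : ℝ × ℝ × ℝ) = a • ((1, 0, 0) : ℝ × ℝ × ℝ) + b • ((0, 1, 0) : ℝ × ℝ × ℝ)
      + c • ((0, 0, 1) : ℝ × ℝ × ℝ) := by simp
  rw [this, map_add, map_add, map_smul, map_smul, map_smul]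
  rfl

theorem DW_q {T : ℝ} {f : ℝ × ℝ × ℝ → ℝ} (hf : ContDiffOn ℝ (⊤ : ℕ∞) f (slab T)) (q θ τ : ℝ)
    (h0 : 0 ≤ τ) (hT : τ < T) : HasDerivAt (fun x => f (x, θ, τ)) (DW T (1, 0, 0) f (q, θ, τ)) q := by
  rw [← hasDerivWithinAt_univ]
  have := DW_curve hf (A := Set.univ) (t := q) (x := fun x => x) (y := fun _ => θ) (z := fun _ => τ)
    (Set.mem_univ _) (fun _ _ => ⟨h0, hT⟩) (hasDerivWithinAt_id q _) (hasDerivWithinAt_const _ _ _)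
    (hasDerivWithinAt_const _ _ _)
  simpa using this

theorem DW_theta {T : ℝ} {f : ℝ × ℝ × ℝ → ℝ} (hf : ContDiffOn ℝ (⊤ : ℕ∞) f (slab T)) (q θ τ : ℝ)
    (h0 : 0 ≤ τ) (hT : τ < T) : HasDerivAt (fun x => f (q, x, τ)) (DW T (0, 1, 0) f (q, θ, τ)) θ := by
  rw [← hasDerivWithinAt_univ]
  have := DW_curve hf (A := Set.univ) (t := θ) (x := fun _ => q) (y := fun x => x) (z := fun _ => τ)
    (Set.mem_univ _) (fun _ _ => ⟨h0, hT⟩) (hasDerivWithinAt_const _ _ _) (hasDerivWithinAt_id θ _)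
    (hasDerivWithinAt_const _ _ _)
  simpa using this

theorem DW_tau {T : ℝ} {f : ℝ × ℝ × ℝ → ℝ} (hf : ContDiffOn ℝ (⊤ : ℕ∞) f (slab T)) (q θ τ : ℝ)
    (h0 : 0 ≤ τ) (hT : τ < T) :
    HasDerivWithinAt (fun x => f (q, θ, x)) (DW T (0, 0, 1) f (q, θ, τ)) (Set.Ico 0 T) τ := by
  have := DW_curve hf (A := Set.Ico 0 T) (t := τ) (x := fun _ => q) (y := fun _ => θ) (z := fun x => x)
    ⟨h0, hT⟩ (fun _ h => h) (hasDerivWithinAt_const _ _ _) (hasDerivWithinAt_const _ _ _)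
    (hasDerivWithinAt_id τ _)
  simpa using this

/-- derivatives of a function which pointwise is `0` or `g`. -/
theorem deriv_zero_or (f g g' : ℝ → ℝ) (h : ∀ x, f x = 0 ∨ f x = g x)
    (hg : ∀ x, HasDerivAt g (g' x) x) (x : ℝ) : deriv f x = 0 ∨ deriv f x = g' x := by
  by_cases hd : DifferentiableAt ℝ f x
  swap
  · left; exact deriv_zero_of_not_differentiableAt hd
  have hf := hd.hasDerivAt
  have hs := hasDerivAt_iff_tendsto_slope.1 hf
  have hcont : Tendsto f (𝓝[≠] x) (𝓝 (f x)) := hf.continuousAt.tendsto.mono_left nhdsWithin_le_nhds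
  by_cases hfr : ∃ᶠ y in 𝓝[≠] x, f y = 0
  · left
    have hfx : f x = 0 := by
      by_contra hne
      have := hcont.eventually_ne hne
      exact hfr (this.mono fun y hy => hy)
    by_contra hne
    have := hs.eventually_ne hne
    refine hfr (this.mono fun y hy h0 => hy ?_)
    simp [slope, h0, hfx]
  · right
    have hev : ∀ᶠ y in 𝓝[≠] x, f y = g y := by
      rw [not_frequently] at hfr
      filter_upwards [hfr] with y hy
      exact (h y).resolve_left hy
    have hfx : f x = g x := by
      have h2 : Tendsto g (𝓝[≠] x) (𝓝 (g x)) :=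
        (hg x).continuousAt.tendsto.mono_left nhdsWithin_le_nhds
      exact tendsto_nhds_unique hcont (h2.congr' (hev.mono fun y hy => hy.symm))
    have h3 := hasDerivAt_iff_tendsto_slope.1 (hg x)
    refine tendsto_nhds_unique hs (h3.congr' (hev.mono fun y hy => ?_))
    simp [slope, hy, hfx]

theorem iter_deriv_zero_or (f : ℝ → ℝ) (g : ℕ → ℝ → ℝ) (h : ∀ x, f x = 0 ∨ f x = g 0 x)
    (hg : ∀ n x, HasDerivAt (g n) (g (n + 1) x) x) (n : ℕ) :
    ∀ x : ℝ, deriv^[n] f x = 0 ∨ deriv^[n] f x = g n x := by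
  induction n with
  | zero => exact h
  | succ n ih =>
    intro x
    rw [Function.iterate_succ_apply']
    exact deriv_zero_or _ (g n) (g (n + 1)) ih (hg n) x

theorem tau_deriv_zero_or {T : ℝ} (hT : 0 < T) (f : ℝ → ℝ) (g : ℕ → ℝ → ℝ)
    (h : ∀ t, 0 ≤ t → t < T → f t = g 0 t)
    (hg : ∀ n t, 0 ≤ t → t < T → HasDerivWithinAt (g n) (g (n + 1) t) (Set.Ico 0 T) t) (n : ℕ) :
    (∀ t, 0 < t → t < T → deriv^[n] f t = g n t) ∧ (deriv^[n] f 0 = 0 ∨ deriv^[n] f 0 = g n 0) := by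
  induction n with
  | zero => exact ⟨fun t h1 h2 => h t h1.le h2, Or.inr (h 0 le_rfl hT)⟩
  | succ n ih =>
    rw [Function.iterate_succ_apply']
    obtain ⟨ih1, ih2⟩ := ih
    constructor
    · intro t h1 h2
      have he : deriv^[n] f =ᶠ[𝓝 t] g n := by
        filter_upwards [Ioo_mem_nhds h1 h2] with u hu
        exact ih1 u hu.1 hu.2
      rw [he.deriv_eq]
      exact ((hg n t h1.le h2).hasDerivAt (Ico_mem_nhds h1 h2)).deriv
    · set F := deriv^[n] f
      by_cases hd : DifferentiableAt ℝ F 0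
      swap
      · left; exact deriv_zero_of_not_differentiableAt hd
      right
      have hg0 := hg n 0 le_rfl hT
      have hne : (𝓝[Set.Ioo 0 T] (0:ℝ)).NeBot := by
        rw [nhdsWithin_Ioo_eq_nhdsGT hT]; infer_instance
      have e0 : F 0 = g n 0 := by
        have c1 : Tendsto F (𝓝[Set.Ioo 0 T] 0) (𝓝 (F 0)) :=
          hd.continuousAt.tendsto.mono_left nhdsWithin_le_nhds
        have c2 : Tendsto (g n) (𝓝[Set.Ioo 0 T] 0) (𝓝 (g n 0)) :=
          hg0.continuousWithinAt.tendsto.mono_left (nhdsWithin_mono _ Set.Ioo_subset_Ico_self)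
        refine tendsto_nhds_unique c1 (c2.congr' ?_)
        filter_upwards [self_mem_nhdsWithin] with u hu
        exact (ih1 u hu.1 hu.2).symm
      have h3 : HasDerivWithinAt (g n) (deriv F 0) (Set.Ico 0 T) 0 := by
        refine hd.hasDerivAt.hasDerivWithinAt.congr (fun u hu => ?_) e0.symm
        rcases hu.1.eq_or_lt with h | h
        · rw [← h]; exact e0.symm
        · exact (ih1 u h hu.2).symm
      exact (uniqueDiffOn_Ico 0 T 0 ⟨le_rfl, hT⟩).eq_deriv _ h3 hg0

/-- genuine mixed derivative within the slab -/
noncomputable def GG (T : ℝ) (m a l : ℕ) (f : ℝ × ℝ × ℝ → ℝ) : ℝ × ℝ × ℝ → ℝ :=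
  (DW T (1, 0, 0))^[m] ((DW T (0, 1, 0))^[a] ((DW T (0, 0, 1))^[l] f))

theorem GG_smooth {T : ℝ} (m a l : ℕ) {f : ℝ × ℝ × ℝ → ℝ} (hf : ContDiffOn ℝ (⊤ : ℕ∞) f (slab T)) :
    ContDiffOn ℝ (⊤ : ℕ∞) (GG T m a l f) (slab T) :=
  DW_iter_smooth _ (DW_iter_smooth _ (DW_iter_smooth _ hf _) _) _

theorem mderiv_zero_or {T : ℝ} (V : ℝ → ℝ → ℝ → ℝ)
    (hV : ContDiffOn ℝ (⊤ : ℕ∞) (fun p : ℝ × ℝ × ℝ => V p.1 p.2.1 p.2.2) (slab T))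
    (m a l : ℕ) (q θ τ : ℝ) (h0 : 0 ≤ τ) (hT : τ < T) :
    mderiv m a l V q θ τ = 0 ∨ mderiv m a l V q θ τ =
      GG T m a l (fun p : ℝ × ℝ × ℝ => V p.1 p.2.1 p.2.2) (q, θ, τ) := by
  set f : ℝ × ℝ × ℝ → ℝ := fun p => V p.1 p.2.1 p.2.2 with hf
  have hT0 : 0 < T := h0.trans_lt hT
  have s1 : ∀ q θ, deriv^[l] (fun τ' => V q θ τ') τ = 0 ∨
      deriv^[l] (fun τ' => V q θ τ') τ = (DW T (0, 0, 1))^[l] f (q, θ, τ) := by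
    intro q θ
    have := tau_deriv_zero_or hT0 (fun τ' => V q θ τ') (fun n t => (DW T (0, 0, 1))^[n] f (q, θ, t))
      (fun t _ _ => rfl) (fun n t h1 h2 => by
        rw [Function.iterate_succ_apply']
        exact DW_tau (DW_iter_smooth _ hV n) q θ t h1 h2) l
    rcases h0.eq_or_lt with h | h
    · rw [← h]; exact this.2
    · exact Or.inr (this.1 τ h hT)
  have s2 : ∀ q θ, deriv^[a] (fun θ' => deriv^[l] (fun τ' => V q θ' τ') τ) θ = 0 ∨
      deriv^[a] (fun θ' => deriv^[l] (fun τ' => V q θ' τ') τ) θ =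
        (DW T (0, 1, 0))^[a] ((DW T (0, 0, 1))^[l] f) (q, θ, τ) := by
    intro q
    exact iter_deriv_zero_or _ (fun n t => (DW T (0, 1, 0))^[n] ((DW T (0, 0, 1))^[l] f) (q, t, τ))
      (fun θ => s1 q θ) (fun n t => by
        rw [Function.iterate_succ_apply']
        exact DW_theta (DW_iter_smooth _ (DW_iter_smooth _ hV l) n) q t τ h0 hT) a
  unfold mderiv GG
  exact iter_deriv_zero_or _ (fun n t => (DW T (1, 0, 0))^[n] ((DW T (0, 1, 0))^[a] ((DW T (0, 0, 1))^[l] f)) (t, θ, τ))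
      (fun q => s2 q θ) (fun n t => by
        rw [Function.iterate_succ_apply']
        exact DW_q (DW_iter_smooth _ (DW_iter_smooth _ (DW_iter_smooth _ hV l) a) n) t θ τ h0 hT) m q

end

section

/-- the Jacobian in compactified coordinates -/
def kh (h : ℝ × ℝ × ℝ → ℝ) (p : ℝ × ℝ × ℝ) : ℝ := 1 + p.1 ^ 3 * h p

def OO (h : ℝ × ℝ × ℝ → ℝ) : Set (ℝ × ℝ × ℝ) := {p | kh h p ≠ 0}

/-- `G` pulled back by the flow is `ρ^n` times a smooth function. -/
def FlowRep (T c : ℝ) (N h : ℝ × ℝ × ℝ → ℝ) (n : ℕ) (G : ℝ × ℝ × ℝ → ℝ) : Prop :=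
  ∃ g : ℝ × ℝ × ℝ → ℝ, ContDiffOn ℝ (⊤ : ℕ∞) g (OO h) ∧
    ∀ ρ θ τ : ℝ, 0 < ρ → 0 ≤ τ → τ < T → (ρ, θ, τ) ∈ OO h →
      G (c - (ρ ^ 2)⁻¹ + N (ρ, θ, τ), θ, τ) = ρ ^ n * g (ρ, θ, τ)

theorem kh_smooth {h : ℝ × ℝ × ℝ → ℝ} (hh : ContDiff ℝ (⊤ : ℕ∞) h) : ContDiff ℝ (⊤ : ℕ∞) (kh h) := by
  unfold kh; fun_prop

theorem OO_open {h : ℝ × ℝ × ℝ → ℝ} (hh : ContDiff ℝ (⊤ : ℕ∞) h) : IsOpen (OO h) :=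
  isOpen_ne_fun (kh_smooth hh).continuous continuous_const

theorem pdO_smooth {O : Set (ℝ × ℝ × ℝ)} (hO : IsOpen O) {g : ℝ × ℝ × ℝ → ℝ}
    (hg : ContDiffOn ℝ (⊤ : ℕ∞) g O) (v : ℝ × ℝ × ℝ) :
    ContDiffOn ℝ (⊤ : ℕ∞) (fun p => fderiv ℝ g p v) O :=
  (hg.fderiv_of_isOpen hO (by simp)).clm_apply contDiffOn_const

theorem pd_q {O : Set (ℝ × ℝ × ℝ)} (hO : IsOpen O) {g : ℝ × ℝ × ℝ → ℝ}
    (hg : ContDiffOn ℝ (⊤ : ℕ∞) g O) {ρ θ τ : ℝ} (hp : (ρ, θ, τ) ∈ O) :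
    HasDerivAt (fun x => g (x, θ, τ)) (fderiv ℝ g (ρ, θ, τ) (1, 0, 0)) ρ := by
  have h1 : HasFDerivAt g (fderiv ℝ g (ρ, θ, τ)) (ρ, θ, τ) :=
    ((hg.differentiableOn (by simp)).differentiableAt (hO.mem_nhds hp)).hasFDerivAt
  have h2 : HasDerivAt (fun x : ℝ => (x, θ, τ)) (1, 0, 0) ρ :=
    (hasDerivAt_id ρ).prodMk ((hasDerivAt_const _ _).prodMk (hasDerivAt_const _ _))
  exact h1.comp_hasDerivAt ρ h2

theorem pd_theta {O : Set (ℝ × ℝ × ℝ)} (hO : IsOpen O) {g : ℝ × ℝ × ℝ → ℝ}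
    (hg : ContDiffOn ℝ (⊤ : ℕ∞) g O) {ρ θ τ : ℝ} (hp : (ρ, θ, τ) ∈ O) :
    HasDerivAt (fun x => g (ρ, x, τ)) (fderiv ℝ g (ρ, θ, τ) (0, 1, 0)) θ := by
  have h1 : HasFDerivAt g (fderiv ℝ g (ρ, θ, τ)) (ρ, θ, τ) :=
    ((hg.differentiableOn (by simp)).differentiableAt (hO.mem_nhds hp)).hasFDerivAt
  have h2 : HasDerivAt (fun x : ℝ => (ρ, x, τ)) (0, 1, 0) θ :=
    (hasDerivAt_const _ _).prodMk ((hasDerivAt_id _).prodMk (hasDerivAt_const _ _))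
  exact h1.comp_hasDerivAt θ h2

theorem pd_tau {O : Set (ℝ × ℝ × ℝ)} (hO : IsOpen O) {g : ℝ × ℝ × ℝ → ℝ}
    (hg : ContDiffOn ℝ (⊤ : ℕ∞) g O) {ρ θ τ : ℝ} (hp : (ρ, θ, τ) ∈ O) :
    HasDerivAt (fun x => g (ρ, θ, x)) (fderiv ℝ g (ρ, θ, τ) (0, 0, 1)) τ := by
  have h1 : HasFDerivAt g (fderiv ℝ g (ρ, θ, τ)) (ρ, θ, τ) :=
    ((hg.differentiableOn (by simp)).differentiableAt (hO.mem_nhds hp)).hasFDerivAt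
  have h2 : HasDerivAt (fun x : ℝ => (ρ, θ, x)) (0, 0, 1) τ :=
    (hasDerivAt_const _ _).prodMk ((hasDerivAt_const _ _).prodMk (hasDerivAt_id _))
  exact h1.comp_hasDerivAt τ h2

section
variable {T c : ℝ} {N h G : ℝ × ℝ × ℝ → ℝ}

/-- derivative identity in the radial direction. -/
theorem rep_q_identity (hh : ContDiff ℝ (⊤ : ℕ∞) h)
    (hNρ : ∀ ρ θ τ, HasDerivAt (fun x => N (x, θ, τ)) (2 * h (ρ, θ, τ)) ρ)
    (hG : ContDiffOn ℝ (⊤ : ℕ∞) G (slab T)) {n : ℕ} {g : ℝ × ℝ × ℝ → ℝ}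
    (hg : ContDiffOn ℝ (⊤ : ℕ∞) g (OO h))
    (hrep : ∀ ρ θ τ : ℝ, 0 < ρ → 0 ≤ τ → τ < T → (ρ, θ, τ) ∈ OO h →
      G (c - (ρ ^ 2)⁻¹ + N (ρ, θ, τ), θ, τ) = ρ ^ n * g (ρ, θ, τ))
    {ρ θ τ : ℝ} (hρ : 0 < ρ) (h0 : 0 ≤ τ) (hT : τ < T) (hO : (ρ, θ, τ) ∈ OO h) :
    DW T (1, 0, 0) G (c - (ρ ^ 2)⁻¹ + N (ρ, θ, τ), θ, τ) =
      (n * ρ ^ (n - 1) * g (ρ, θ, τ) + ρ ^ n * fderiv ℝ g (ρ, θ, τ) (1, 0, 0)) *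
        (ρ ^ 3 / (2 * kh h (ρ, θ, τ))) := by
  have hOo := OO_open hh
  have hx : HasDerivAt (fun x : ℝ => c - (x ^ 2)⁻¹ + N (x, θ, τ)) (2 * kh h (ρ, θ, τ) / ρ ^ 3) ρ := by
    have h1 : HasDerivAt (fun x : ℝ => (x ^ 2)⁻¹) (-(2 * ρ) / (ρ ^ 2) ^ 2) ρ := by
      have := (hasDerivAt_pow 2 ρ).fun_inv (by positivity)
      simpa using this
    refine HasDerivAt.congr_deriv ((h1.const_sub c).add (hNρ ρ θ τ)) ?_
    unfold kh
    field_simp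
  have h1 := DW_q hG (c - (ρ ^ 2)⁻¹ + N (ρ, θ, τ)) θ τ h0 hT
  have h2 : HasDerivAt (fun x : ℝ => G (c - (x ^ 2)⁻¹ + N (x, θ, τ), θ, τ)) _ ρ :=
    HasDerivAt.comp ρ (h₂ := fun y => G (y, θ, τ)) h1 hx
  have h3 : HasDerivAt (fun x : ℝ => x ^ n * g (x, θ, τ))
      (n * ρ ^ (n - 1) * g (ρ, θ, τ) + ρ ^ n * fderiv ℝ g (ρ, θ, τ) (1, 0, 0)) ρ :=
    (hasDerivAt_pow n ρ).mul (pd_q hOo hg hO)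
  have he : (fun x : ℝ => G (c - (x ^ 2)⁻¹ + N (x, θ, τ), θ, τ)) =ᶠ[𝓝 ρ] fun x => x ^ n * g (x, θ, τ) := by
    have hc : Continuous (fun x : ℝ => (x, θ, τ)) := by fun_prop
    filter_upwards [Ioi_mem_nhds hρ, hc.continuousAt.preimage_mem_nhds (hOo.mem_nhds hO)] with x hx1 hx2
    exact hrep x θ τ hx1 h0 hT hx2
  have h4 := (h3.congr_of_eventuallyEq he).unique h2
  rw [h4]
  have hk : kh h (ρ, θ, τ) ≠ 0 := hO
  field_simp

theorem rep_q (hh : ContDiff ℝ (⊤ : ℕ∞) h)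
    (hNρ : ∀ ρ θ τ, HasDerivAt (fun x => N (x, θ, τ)) (2 * h (ρ, θ, τ)) ρ)
    (hG : ContDiffOn ℝ (⊤ : ℕ∞) G (slab T)) {n : ℕ} (hr : FlowRep T c N h n G) :
    FlowRep T c N h (n + 2) (DW T (1, 0, 0) G) := by
  obtain ⟨g, hg, hrep⟩ := hr
  have hk : ContDiffOn ℝ (⊤ : ℕ∞) (fun p => 2 * kh h p) (OO h) := (contDiff_const.mul (kh_smooth hh)).contDiffOn
  have hg1 := pdO_smooth (OO_open hh) hg (1, 0, 0)
  refine ⟨fun p => ((n : ℝ) * g p + p.1 * fderiv ℝ g p (1, 0, 0)) / (2 * kh h p), ?_, ?_⟩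
  · refine ContDiffOn.div ((contDiffOn_const.mul hg).add (contDiffOn_fst.mul hg1)) hk ?_
    intro p hp
    exact mul_ne_zero two_ne_zero hp
  · intro ρ θ τ hρ h0 hT hO
    rw [rep_q_identity hh hNρ hG hg hrep hρ h0 hT hO]
    have hk : kh h (ρ, θ, τ) ≠ 0 := hO
    rcases n with _ | n
    · simp; field_simp
    · simp only [Nat.add_sub_cancel]
      field_simp
      ring

theorem rep_q0 (hh : ContDiff ℝ (⊤ : ℕ∞) h)
    (hNρ : ∀ ρ θ τ, HasDerivAt (fun x => N (x, θ, τ)) (2 * h (ρ, θ, τ)) ρ)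
    (hG : ContDiffOn ℝ (⊤ : ℕ∞) G (slab T)) (hr : FlowRep T c N h 0 G) :
    FlowRep T c N h 3 (DW T (1, 0, 0) G) := by
  obtain ⟨g, hg, hrep⟩ := hr
  have hk : ContDiffOn ℝ (⊤ : ℕ∞) (fun p => 2 * kh h p) (OO h) := (contDiff_const.mul (kh_smooth hh)).contDiffOn
  have hg1 := pdO_smooth (OO_open hh) hg (1, 0, 0)
  refine ⟨fun p => (fderiv ℝ g p (1, 0, 0)) / (2 * kh h p), ?_, ?_⟩
  · refine ContDiffOn.div hg1 hk ?_
    intro p hp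
    exact mul_ne_zero two_ne_zero hp
  · intro ρ θ τ hρ h0 hT hO
    rw [rep_q_identity hh hNρ hG hg hrep hρ h0 hT hO]
    have hk : kh h (ρ, θ, τ) ≠ 0 := hO
    simp; field_simp

theorem rep_theta (hh : ContDiff ℝ (⊤ : ℕ∞) h) (hN : ContDiff ℝ (⊤ : ℕ∞) N)
    (hNρ : ∀ ρ θ τ, HasDerivAt (fun x => N (x, θ, τ)) (2 * h (ρ, θ, τ)) ρ)
    (hG : ContDiffOn ℝ (⊤ : ℕ∞) G (slab T)) (hr : FlowRep T c N h 0 G) :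
    FlowRep T c N h 0 (DW T (0, 1, 0) G) := by
  have hq := rep_q0 hh hNρ hG hr
  obtain ⟨g, hg, hrep⟩ := hr
  obtain ⟨gq, hgq, hrepq⟩ := hq
  have hOo := OO_open hh
  have hg1 := pdO_smooth hOo hg (0, 1, 0)
  have hN1 := pdO_smooth isOpen_univ hN.contDiffOn (0, 1, 0)
  refine ⟨fun p => fderiv ℝ g p (0, 1, 0) - fderiv ℝ N p (0, 1, 0) * (p.1 ^ 3 * gq p), ?_, ?_⟩
  · exact hg1.sub ((hN1.mono (Set.subset_univ _)).mul ((contDiffOn_fst.pow 3).mul hgq))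
  · intro ρ θ τ hρ h0 hT hO
    have hNd := pd_theta isOpen_univ hN.contDiffOn (Set.mem_univ (ρ, θ, τ))
    have h1 := DW_curve hG (A := Set.univ) (t := θ) (x := fun x => c - (ρ ^ 2)⁻¹ + N (ρ, x, τ))
      (y := fun x => x) (z := fun _ => τ)
      (Set.mem_univ _) (fun _ _ => ⟨h0, hT⟩) (hNd.const_add _).hasDerivWithinAt (hasDerivWithinAt_id θ _)
      (hasDerivWithinAt_const _ _ _)
    rw [hasDerivWithinAt_univ] at h1
    have he : (fun x : ℝ => G (c - (ρ ^ 2)⁻¹ + N (ρ, x, τ), x, τ)) =ᶠ[𝓝 θ] fun x => g (ρ, x, τ) := by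
      have hc : Continuous (fun x : ℝ => (ρ, x, τ)) := by fun_prop
      filter_upwards [hc.continuousAt.preimage_mem_nhds (hOo.mem_nhds hO)] with x hx2
      rw [hrep ρ x τ hρ h0 hT hx2]; simp
    have h4 := ((pd_theta hOo hg hO).congr_of_eventuallyEq he).unique h1
    rw [hrepq ρ θ τ hρ h0 hT hO] at h4
    simp only [pow_zero, one_mul]
    linarith

theorem rep_tau (hh : ContDiff ℝ (⊤ : ℕ∞) h) (hN : ContDiff ℝ (⊤ : ℕ∞) N)
    (hNρ : ∀ ρ θ τ, HasDerivAt (fun x => N (x, θ, τ)) (2 * h (ρ, θ, τ)) ρ)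
    (hG : ContDiffOn ℝ (⊤ : ℕ∞) G (slab T)) (hr : FlowRep T c N h 0 G) :
    FlowRep T c N h 0 (DW T (0, 0, 1) G) := by
  have hq := rep_q0 hh hNρ hG hr
  obtain ⟨g, hg, hrep⟩ := hr
  obtain ⟨gq, hgq, hrepq⟩ := hq
  have hOo := OO_open hh
  have hg1 := pdO_smooth hOo hg (0, 0, 1)
  have hN1 := pdO_smooth isOpen_univ hN.contDiffOn (0, 0, 1)
  refine ⟨fun p => fderiv ℝ g p (0, 0, 1) - fderiv ℝ N p (0, 0, 1) * (p.1 ^ 3 * gq p), ?_, ?_⟩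
  · exact hg1.sub ((hN1.mono (Set.subset_univ _)).mul ((contDiffOn_fst.pow 3).mul hgq))
  · intro ρ θ τ hρ h0 hT hO
    have hNd := pd_tau isOpen_univ hN.contDiffOn (Set.mem_univ (ρ, θ, τ))
    have h1 := DW_curve hG (A := Set.Ico 0 T) (t := τ) (x := fun x => c - (ρ ^ 2)⁻¹ + N (ρ, θ, x))
      (y := fun _ => θ) (z := fun x => x)
      ⟨h0, hT⟩ (fun _ h => h) (hNd.const_add _).hasDerivWithinAt (hasDerivWithinAt_const _ _ _)
      (hasDerivWithinAt_id τ _)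
    have he : (fun x : ℝ => G (c - (ρ ^ 2)⁻¹ + N (ρ, θ, x), θ, x)) =ᶠ[𝓝[Set.Ico 0 T] τ] fun x => g (ρ, θ, x) := by
      have hc : Continuous (fun x : ℝ => (ρ, θ, x)) := by fun_prop
      filter_upwards [mem_nhdsWithin_of_mem_nhds (hc.continuousAt.preimage_mem_nhds (hOo.mem_nhds hO)),
        self_mem_nhdsWithin] with x hx2 hx3
      rw [hrep ρ θ x hρ hx3.1 hx3.2 hx2]; simp
    have h5 := (pd_tau hOo hg hO).hasDerivWithinAt (s := Set.Ico 0 T)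
    have h6 := h5.congr_of_eventuallyEq he (by rw [hrep ρ θ τ hρ h0 hT hO]; simp)
    have h4 := (uniqueDiffOn_Ico 0 T τ ⟨h0, hT⟩).eq_deriv _ h6 h1
    rw [hrepq ρ θ τ hρ h0 hT hO] at h4
    simp only [pow_zero, one_mul]
    linarith

theorem rep_GG0 (hh : ContDiff ℝ (⊤ : ℕ∞) h) (hN : ContDiff ℝ (⊤ : ℕ∞) N)
    (hNρ : ∀ ρ θ τ, HasDerivAt (fun x => N (x, θ, τ)) (2 * h (ρ, θ, τ)) ρ)
    (hG : ContDiffOn ℝ (⊤ : ℕ∞) G (slab T)) (hr : FlowRep T c N h 0 G) (a l : ℕ) :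
    FlowRep T c N h 0 (GG T 0 a l G) := by
  have h1 : FlowRep T c N h 0 ((DW T (0, 0, 1))^[l] G) := by
    induction l with
    | zero => exact hr
    | succ l ih =>
      rw [Function.iterate_succ_apply']
      exact rep_tau hh hN hNρ (DW_iter_smooth _ hG l) ih
  have hG1 := DW_iter_smooth (0, 0, 1) hG l
  unfold GG
  rw [Function.iterate_zero_apply]
  induction a with
  | zero => exact h1
  | succ a ih =>
    rw [Function.iterate_succ_apply']
    exact rep_theta hh hN hNρ (DW_iter_smooth _ hG1 a) ih

theorem rep_GG (hh : ContDiff ℝ (⊤ : ℕ∞) h) (hN : ContDiff ℝ (⊤ : ℕ∞) N)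
    (hNρ : ∀ ρ θ τ, HasDerivAt (fun x => N (x, θ, τ)) (2 * h (ρ, θ, τ)) ρ)
    (hG : ContDiffOn ℝ (⊤ : ℕ∞) G (slab T)) (hr : FlowRep T c N h 0 G) (m a l : ℕ) :
    FlowRep T c N h (3 + 2 * m) (GG T (m + 1) a l G) := by
  induction m with
  | zero =>
    have := rep_q0 hh hNρ (GG_smooth 0 a l hG) (rep_GG0 hh hN hNρ hG hr a l)
    exact this
  | succ m ih =>
    have := rep_q hh hNρ (GG_smooth (m + 1) a l hG) ih
    have e : GG T (m + 1 + 1) a l G = DW T (1, 0, 0) (GG T (m + 1) a l G) := by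
      unfold GG; rw [Function.iterate_succ_apply']
    rw [e]
    exact this
end

end

section

theorem rep_far_bound {T c : ℝ} {N h G : ℝ × ℝ × ℝ → ℝ} (hh : ContDiff ℝ (⊤ : ℕ∞) h)
    (hN : ContDiff ℝ (⊤ : ℕ∞) N) {n : ℕ} (hr : FlowRep T c N h n G) {b : ℝ} (hb : 0 < b) (hbT : b < T) :
    ∃ R C : ℝ, 0 ≤ C ∧ ∀ q θ τ : ℝ, q ≤ -R → θ ∈ Set.Icc 0 (2 * Real.pi) → 0 ≤ τ → τ ≤ b →
      |G (q, θ, τ)| ≤ C * (1 + |q|) ^ (-((n : ℝ) / 2)) := by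
  obtain ⟨g, hg, hrep⟩ := hr
  set K : ℝ → Set (ℝ × ℝ × ℝ) := fun r => Set.Icc 0 r ×ˢ (Set.Icc 0 (2 * Real.pi) ×ˢ Set.Icc 0 b) with hK
  have hKc : ∀ r, IsCompact (K r) := fun r => isCompact_Icc.prod (isCompact_Icc.prod isCompact_Icc)
  have hKmem : ∀ r, 0 ≤ r → ((0, 0, 0) : ℝ × ℝ × ℝ) ∈ K r := fun r hr0 =>
    ⟨⟨le_rfl, hr0⟩, ⟨le_rfl, by positivity⟩, ⟨le_rfl, hb.le⟩⟩
  obtain ⟨Ch, hCh⟩ := (hKc 1).exists_bound_of_continuousOn hh.continuous.continuousOn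
  have hCh0 : 0 ≤ Ch := (norm_nonneg _).trans (hCh _ (hKmem 1 zero_le_one))
  set r := 1 / (Ch + 1) with hrdef
  have hr0 : 0 < r := by positivity
  have hr1 : r ≤ 1 := by rw [hrdef, div_le_one (by positivity)]; linarith
  have hrC : r * Ch < 1 := by
    rw [hrdef, div_mul_eq_mul_div, one_mul, div_lt_one (by positivity)]; linarith
  have hKO : K r ⊆ OO h := by
    rintro ⟨ρ, θ, τ⟩ ⟨h1, h2⟩
    have h1' : 0 ≤ ρ ∧ ρ ≤ r := h1
    have hb1 : |h (ρ, θ, τ)| ≤ Ch := hCh (ρ, θ, τ) ⟨⟨h1'.1, h1'.2.trans hr1⟩, h2⟩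
    have h3 : |ρ ^ 3 * h (ρ, θ, τ)| < 1 := by
      rw [abs_mul, abs_of_nonneg (pow_nonneg h1'.1 3)]
      have : ρ ^ 3 ≤ ρ := by
        have := pow_le_pow_of_le_one h1'.1 (h1'.2.trans hr1) (show 1 ≤ 3 by norm_num)
        simpa using this
      calc ρ ^ 3 * |h (ρ, θ, τ)| ≤ r * Ch := by
            apply mul_le_mul (this.trans h1'.2) hb1 (abs_nonneg _) hr0.le
        _ < 1 := hrC
    have h4 := (abs_lt.1 h3).1
    change kh h (ρ, θ, τ) ≠ 0
    simp only [kh]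
    linarith
  obtain ⟨CN, hCN⟩ := (hKc r).exists_bound_of_continuousOn hN.continuous.continuousOn
  obtain ⟨Cg, hCg⟩ := (hKc r).exists_bound_of_continuousOn (hg.continuousOn.mono hKO)
  have hCN0 : 0 ≤ CN := (norm_nonneg _).trans (hCN _ (hKmem r hr0.le))
  have hCg0 : 0 ≤ Cg := (norm_nonneg _).trans (hCg _ (hKmem r hr0.le))
  set A := 2 + |c| + CN with hA
  have hA0 : 0 < A := by positivity
  refine ⟨-(c - (r ^ 2)⁻¹ - CN), A ^ ((n : ℝ) / 2) * Cg, by positivity, ?_⟩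
  intro q θ τ hq hθ h0 hτ
  rw [neg_neg] at hq
  set Z := CN + |c| + |q| + (r ^ 2)⁻¹ with hZ
  have hrinv : 0 < (r ^ 2)⁻¹ := by positivity
  have hZ0 : 0 < Z := by positivity
  set r' := (Real.sqrt Z)⁻¹ with hr'
  have hr'0 : 0 < r' := by positivity
  have hr'sq : (r' ^ 2)⁻¹ = Z := by rw [hr', inv_pow, inv_inv, Real.sq_sqrt hZ0.le]
  have hr'r : r' ≤ r := by
    have h1 : (r ^ 2)⁻¹ ≤ (r' ^ 2)⁻¹ := by
      rw [hr'sq, hZ]; nlinarith [abs_nonneg c, abs_nonneg q]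
    have h2 : r' ^ 2 ≤ r ^ 2 := (inv_le_inv₀ (by positivity) (by positivity)).1 h1
    exact (pow_le_pow_iff_left₀ hr'0.le hr0.le two_ne_zero).1 h2
  have hNb : ∀ x ∈ Set.Icc r' r, |N (x, θ, τ)| ≤ CN := fun x hx =>
    hCN (x, θ, τ) ⟨⟨hr'0.le.trans hx.1, hx.2⟩, hθ, h0, hτ⟩
  have hcont : ContinuousOn (fun x : ℝ => c - (x ^ 2)⁻¹ + N (x, θ, τ)) (Set.Icc r' r) := by
    have hNc : Continuous (fun x : ℝ => N (x, θ, τ)) := hN.continuous.comp (by fun_prop)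
    refine ContinuousOn.add (continuousOn_const.sub (ContinuousOn.inv₀ (by fun_prop) ?_)) hNc.continuousOn
    intro x hx
    have : 0 < x := hr'0.trans_le hx.1
    positivity
  have hiv := intermediate_value_Icc hr'r hcont
  have hqm : q ∈ Set.Icc (c - (r' ^ 2)⁻¹ + N (r', θ, τ)) (c - (r ^ 2)⁻¹ + N (r, θ, τ)) := by
    have n1 := abs_le.1 (hNb r' ⟨le_rfl, hr'r⟩)
    have n2 := abs_le.1 (hNb r ⟨hr'r, le_rfl⟩)
    constructor
    · rw [hr'sq, hZ]
      linarith [n1.2, le_abs_self c, neg_abs_le q, hrinv]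
    · linarith [n2.1]
  obtain ⟨ρ, hρ, hρq⟩ := hiv hqm
  have hρ0 : 0 < ρ := hr'0.trans_le hρ.1
  have hρK : (ρ, θ, τ) ∈ K r := ⟨⟨hρ0.le, hρ.2⟩, hθ, h0, hτ⟩
  have hGe := hrep ρ θ τ hρ0 h0 (hτ.trans_lt hbT) (hKO hρK)
  simp only at hρq
  rw [hρq] at hGe
  rw [hGe, abs_mul, abs_of_nonneg (pow_nonneg hρ0.le n)]
  have hgb : |g (ρ, θ, τ)| ≤ Cg := hCg _ hρK
  have hρ2 : 1 ≤ (ρ ^ 2)⁻¹ := by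
    rw [one_le_inv₀ (by positivity)]
    exact pow_le_one₀ hρ0.le (hρ.2.trans hr1)
  have hqb : 1 + |q| ≤ A * (ρ ^ 2)⁻¹ := by
    have n1 := abs_le.1 (hNb ρ hρ)
    have : |q| ≤ |c| + (ρ ^ 2)⁻¹ + CN := by
      rw [abs_le]; constructor
      · linarith [n1.1, neg_abs_le c]
      · linarith [n1.2, le_abs_self c]
    have h2 : (1 + |c| + CN) * 1 ≤ (1 + |c| + CN) * (ρ ^ 2)⁻¹ := by gcongr
    rw [hA]; linarith
  have hpos : 0 < 1 + |q| := by positivity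
  have hρ3 : ρ ^ 2 ≤ A / (1 + |q|) := by
    rw [le_div_iff₀ hpos]
    calc ρ ^ 2 * (1 + |q|) ≤ ρ ^ 2 * (A * (ρ ^ 2)⁻¹) := by gcongr
      _ = A := by field_simp
  have hρn : ρ ^ n ≤ A ^ ((n : ℝ) / 2) * (1 + |q|) ^ (-((n : ℝ) / 2)) := by
    calc ρ ^ n = (ρ ^ 2) ^ ((n : ℝ) / 2) := by
          rw [← Real.rpow_natCast ρ 2, ← Real.rpow_mul hρ0.le, ← Real.rpow_natCast]
          congr 1; push_cast; ring
      _ ≤ (A / (1 + |q|)) ^ ((n : ℝ) / 2) := by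
          apply Real.rpow_le_rpow (by positivity) hρ3 (by positivity)
      _ = _ := by rw [Real.div_rpow hA0.le hpos.le, Real.rpow_neg hpos.le]; rfl
  calc ρ ^ n * |g (ρ, θ, τ)| ≤ (A ^ ((n : ℝ) / 2) * (1 + |q|) ^ (-((n : ℝ) / 2))) * Cg := by gcongr
    _ = _ := by ring

theorem mderiv_far_zero {M : ℝ} (V : ℝ → ℝ → ℝ → ℝ) (hM : ∀ q θ τ : ℝ, M < q → V q θ τ = 0)
    (m a l : ℕ) (q θ τ : ℝ) (hq : M < q) : mderiv m a l V q θ τ = 0 := by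
  have hz : ∀ n : ℕ, deriv^[n] (fun _ : ℝ => (0 : ℝ)) = fun _ => 0 := by
    intro n
    induction n with
    | zero => rfl
    | succ n ih => rw [Function.iterate_succ_apply', ih]; funext x; simp
  have h1 : ∀ q, M < q → deriv^[a] (fun θ' => deriv^[l] (fun τ' => V q θ' τ') τ) θ = 0 := by
    intro q hq
    have : (fun θ' => deriv^[l] (fun τ' => V q θ' τ') τ) = fun _ => 0 := by
      funext θ'
      have : (fun τ' => V q θ' τ') = fun _ => 0 := by funext τ'; exact hM q θ' τ' hq
      rw [this, hz]
    rw [this, hz]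
  unfold mderiv
  have h2 : ∀ n : ℕ, ∀ q, M < q → deriv^[n] (fun q' => deriv^[a] (fun θ' => deriv^[l] (fun τ' => V q' θ' τ') τ) θ) q = 0 := by
    intro n
    induction n with
    | zero => exact h1
    | succ n ih =>
      intro q hq
      rw [Function.iterate_succ_apply']
      have : deriv^[n] (fun q' => deriv^[a] (fun θ' => deriv^[l] (fun τ' => V q' θ' τ') τ) θ) =ᶠ[𝓝 q] fun _ => 0 := by
        filter_upwards [Ioi_mem_nhds hq] with x hx
        exact ih x hx
      rw [this.deriv_eq]; simp
  exact h2 m q hq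

theorem iter_deriv_periodic (f : ℝ → ℝ) (c : ℝ) (hf : Function.Periodic f c) (n : ℕ) :
    Function.Periodic (deriv^[n] f) c := by
  induction n with
  | zero => exact hf
  | succ n ih =>
    rw [Function.iterate_succ_apply']
    intro x
    rw [← deriv_comp_add_const]
    congr 1
    funext y
    exact ih y

theorem mderiv_periodic (V : ℝ → ℝ → ℝ → ℝ) (c : ℝ) (hV : ∀ q θ τ : ℝ, V q (θ + c) τ = V q θ τ)
    (m a l : ℕ) (q τ : ℝ) : Function.Periodic (fun θ => mderiv m a l V q θ τ) c := by
  intro θ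
  have key : (fun q' => deriv^[a] (fun θ' => deriv^[l] (fun τ' => V q' θ' τ') τ) (θ + c)) =
      fun q' => deriv^[a] (fun θ' => deriv^[l] (fun τ' => V q' θ' τ') τ) θ := by
    funext q'
    apply iter_deriv_periodic
    intro θ'
    have h2 : (fun τ' => V q' (θ' + c) τ') = fun τ' => V q' θ' τ' := by
      funext τ'
      exact hV q' θ' τ'
    show deriv^[l] (fun τ' => V q' (θ' + c) τ') τ = _
    rw [h2]
  simp only [mderiv]
  rw [key]

theorem mderiv_bound {T M c : ℝ} (V : ℝ → ℝ → ℝ → ℝ)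
    (hV : ContDiffOn ℝ (⊤ : ℕ∞) (fun p : ℝ × ℝ × ℝ => V p.1 p.2.1 p.2.2) (slab T))
    (hM : ∀ q θ τ : ℝ, M < q → V q θ τ = 0)
    (hper : ∀ q θ τ : ℝ, V q (θ + 2 * Real.pi) τ = V q θ τ)
    {N h : ℝ × ℝ × ℝ → ℝ} (hh : ContDiff ℝ (⊤ : ℕ∞) h)
    (hN : ContDiff ℝ (⊤ : ℕ∞) N) {n : ℕ} (m a l : ℕ)
    (hr : FlowRep T c N h n (GG T m a l (fun p : ℝ × ℝ × ℝ => V p.1 p.2.1 p.2.2)))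
    {b : ℝ} (hb : 0 < b) (hbT : b < T) :
    ∃ C : ℝ, ∀ q θ τ : ℝ, 0 ≤ τ → τ ≤ b →
      |mderiv m a l V q θ τ| ≤ C * (1 + |q|) ^ (-((n : ℝ) / 2)) := by
  set G := GG T m a l (fun p : ℝ × ℝ × ℝ => V p.1 p.2.1 p.2.2) with hG
  obtain ⟨R, C1, hC1, hfar⟩ := rep_far_bound hh hN hr hb hbT
  have hGs := GG_smooth m a l hV
  have hcpt : IsCompact (Set.Icc (-R) M ×ˢ (Set.Icc 0 (2 * Real.pi) ×ˢ Set.Icc 0 b)) :=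
    isCompact_Icc.prod (isCompact_Icc.prod isCompact_Icc)
  obtain ⟨C2, hC2⟩ := hcpt.exists_bound_of_continuousOn
    (hGs.continuousOn.mono (fun p hp => ⟨hp.2.2.1, hp.2.2.2.trans_lt hbT⟩))
  set L := |R| + |M| with hL
  refine ⟨C1 + |C2| * (1 + L) ^ ((n : ℝ) / 2), ?_⟩
  have main : ∀ q θ τ : ℝ, θ ∈ Set.Icc 0 (2 * Real.pi) → 0 ≤ τ → τ ≤ b →
      |mderiv m a l V q θ τ| ≤ (C1 + |C2| * (1 + L) ^ ((n : ℝ) / 2)) * (1 + |q|) ^ (-((n : ℝ) / 2)) := by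
    intro q θ τ hθ h0 hτ
    have hpos : 0 < 1 + |q| := by positivity
    have hw : 0 < (1 + |q|) ^ (-((n : ℝ) / 2)) := by positivity
    have hL0 : 0 ≤ L := by positivity
    rcases mderiv_zero_or V hV m a l q θ τ h0 (hτ.trans_lt hbT) with h | h
    · rw [h, abs_zero]; positivity
    rcases lt_or_ge M q with hq | hq
    · rw [mderiv_far_zero V hM m a l q θ τ hq, abs_zero]; positivity
    rw [h]
    rcases le_or_gt q (-R) with hq2 | hq2
    · refine (hfar q θ τ hq2 hθ h0 hτ).trans ?_
      gcongr
      have : 0 ≤ |C2| * (1 + L) ^ ((n : ℝ) / 2) := by positivity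
      linarith
    · have h1 : |G (q, θ, τ)| ≤ C2 := hC2 (q, θ, τ) ⟨⟨hq2.le, hq⟩, hθ, h0, hτ⟩
      have hqL : |q| ≤ L := by
        rw [abs_le, hL]
        constructor
        · linarith [le_abs_self R, abs_nonneg M]
        · linarith [le_abs_self M, abs_nonneg R]
      have h2 : 1 ≤ (1 + L) ^ ((n : ℝ) / 2) * (1 + |q|) ^ (-((n : ℝ) / 2)) := by
        rw [Real.rpow_neg hpos.le, ← div_eq_mul_inv, one_le_div (by positivity)]
        exact Real.rpow_le_rpow hpos.le (by linarith) (by positivity)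
      calc |G (q, θ, τ)| ≤ |C2| * 1 := by linarith [le_abs_self C2]
        _ ≤ |C2| * ((1 + L) ^ ((n : ℝ) / 2) * (1 + |q|) ^ (-((n : ℝ) / 2))) := by gcongr
        _ ≤ _ := by
          have : 0 ≤ C1 * (1 + |q|) ^ (-((n : ℝ) / 2)) := by positivity
          linarith
  intro q θ τ h0 hτ
  obtain ⟨θ', hθ', he⟩ := (mderiv_periodic V _ hper m a l q τ).exists_mem_Ico₀ Real.two_pi_pos θ
  have he2 : mderiv m a l V q θ τ = mderiv m a l V q θ' τ := he
  rw [he2]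
  exact main q θ' τ ⟨hθ'.1, hθ'.2.le⟩ h0 hτ

end

section

noncomputable def dhat (d : Fin 3 → Fin 3 → ℝ) (θ : ℝ) : ℝ :=
  ∑ i : Fin 3, ∑ j : Fin 3, d i j * omegaHat θ i * omegaHat θ j

noncomputable def ehat (e : Fin 3 → Fin 3 → Fin 3 → ℝ) (θ : ℝ) : ℝ :=
  ∑ i : Fin 3, ∑ j : Fin 3, ∑ k : Fin 3, e i j k * omegaHat θ i * omegaHat θ j * omegaHat θ k

theorem omegaHat_smooth (i : Fin 3) : ContDiff ℝ (⊤ : ℕ∞) (fun θ => omegaHat θ i) := by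
  unfold omegaHat
  fin_cases i
  · exact contDiff_const
  · exact Real.contDiff_cos
  · exact Real.contDiff_sin

theorem dhat_smooth (d : Fin 3 → Fin 3 → ℝ) : ContDiff ℝ (⊤ : ℕ∞) (dhat d) := by
  unfold dhat
  refine ContDiff.sum fun i _ => ContDiff.sum fun j _ => ?_
  exact (contDiff_const.mul (omegaHat_smooth i)).mul (omegaHat_smooth j)

theorem ehat_smooth (e : Fin 3 → Fin 3 → Fin 3 → ℝ) : ContDiff ℝ (⊤ : ℕ∞) (ehat e) := by
  unfold ehat
  refine ContDiff.sum fun i _ => ContDiff.sum fun j _ => ContDiff.sum fun k _ => ?_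
  exact ((contDiff_const.mul (omegaHat_smooth i)).mul (omegaHat_smooth j)).mul (omegaHat_smooth k)

theorem pd1_hasDerivAt {f : ℝ × ℝ → ℝ} (hf : ContDiff ℝ (⊤ : ℕ∞) f) (s θ : ℝ) :
    HasDerivAt (fun x => f (x, θ)) (deriv (fun x => f (x, θ)) s) s := by
  have h1 : ContDiff ℝ (⊤ : ℕ∞) (fun x : ℝ => f (x, θ)) :=
    hf.comp (by fun_prop : ContDiff ℝ (⊤ : ℕ∞) fun x : ℝ => (x, θ))
  exact (h1.differentiable (by simp) s).hasDerivAt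

theorem prof_char (M : ℝ) (d : Fin 3 → Fin 3 → ℝ) (e : Fin 3 → Fin 3 → Fin 3 → ℝ)
    (φ0 φ1 : ℝ × ℝ → ℝ) (T : ℝ) (hT : 0 < T) (V : ℝ → ℝ → ℝ → ℝ)
    (hV : IsProfileSol M d e φ0 φ1 T V) :
    ∃ w0 w1 : ℝ × ℝ → ℝ, ContDiff ℝ (⊤ : ℕ∞) w0 ∧ ContDiff ℝ (⊤ : ℕ∞) w1 ∧
      (∀ s θ, HasDerivAt (fun x => F0 φ0 φ1 x θ) (w0 (s, θ)) s) ∧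
      (∀ s θ, HasDerivAt (fun x => w0 (x, θ)) (w1 (s, θ)) s) ∧
      ∀ s θ τ, s ≤ M → 0 ≤ τ → τ < T →
        V (QQ M (dhat d θ) (ehat e θ) (fun x => w0 (x, θ)) (fun x => w1 (x, θ)) s τ) θ τ =
          - ∫ s' in s..M, w0 (s', θ) *
            kk (dhat d θ) (ehat e θ) (fun x => w0 (x, θ)) (fun x => w1 (x, θ)) s' τ := by
  obtain ⟨hVs, hper, hsupp, hin, hpde⟩ := hV
  set f : ℝ × ℝ × ℝ → ℝ := fun p => V p.1 p.2.1 p.2.2 with hf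
  have hfs : ContDiffOn ℝ (⊤ : ℕ∞) f (slab T) := hVs
  have hFs : ContDiff ℝ (⊤ : ℕ∞) (fun p : ℝ × ℝ => F0 φ0 φ1 p.1 p.2) := by
    have h1 : ContDiff ℝ (⊤ : ℕ∞) (fun p : ℝ × ℝ => f (p.1, p.2, 0)) := by
      rw [← contDiffOn_univ]
      exact hfs.comp (by fun_prop : ContDiff ℝ (⊤ : ℕ∞) fun p : ℝ × ℝ => (p.1, p.2, (0:ℝ))).contDiffOn
        (fun p _ => ⟨le_rfl, hT⟩)
    have h2 : (fun p : ℝ × ℝ => F0 φ0 φ1 p.1 p.2) = fun p : ℝ × ℝ => f (p.1, p.2, 0) := by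
      funext p; exact (hin p.1 p.2).symm
    rw [h2]; exact h1
  set w0 : ℝ × ℝ → ℝ := fun p => deriv (fun s => F0 φ0 φ1 s p.2) p.1 with hw0
  have hw0s : ContDiff ℝ (⊤ : ℕ∞) w0 := smooth_pd1 hFs
  set w1 : ℝ × ℝ → ℝ := fun p => deriv (fun s => w0 (s, p.2)) p.1 with hw1
  have hw1s : ContDiff ℝ (⊤ : ℕ∞) w1 := smooth_pd1 hw0s
  have hd0 : ∀ s θ, HasDerivAt (fun x => F0 φ0 φ1 x θ) (w0 (s, θ)) s :=
    fun s θ => pd1_hasDerivAt hFs s θ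
  have hd1 : ∀ s θ, HasDerivAt (fun x => w0 (x, θ)) (w1 (s, θ)) s :=
    fun s θ => pd1_hasDerivAt hw0s s θ
  refine ⟨w0, w1, hw0s, hw1s, hd0, hd1, ?_⟩
  intro s θ τ hs h0 hτ
  have h0s : ContDiff ℝ (⊤ : ℕ∞) (fun x => w0 (x, θ)) :=
    hw0s.comp (by fun_prop : ContDiff ℝ (⊤ : ℕ∞) fun x : ℝ => (x, θ))
  have h1s : ContDiff ℝ (⊤ : ℕ∞) (fun x => w1 (x, θ)) :=
    hw1s.comp (by fun_prop : ContDiff ℝ (⊤ : ℕ∞) fun x : ℝ => (x, θ))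
  -- vanishing at M
  have hz : ∀ g : ℝ → ℝ, Continuous g → (∀ q, M < q → g q = 0) → g M = 0 := by
    intro g hg h
    have h1 : Tendsto g (𝓝[>] M) (𝓝 (g M)) := hg.continuousAt.tendsto.mono_left nhdsWithin_le_nhds
    have h2 : Tendsto g (𝓝[>] M) (𝓝 0) := by
      refine tendsto_const_nhds.congr' ?_
      filter_upwards [self_mem_nhdsWithin] with q hq
      exact (h q hq).symm
    exact tendsto_nhds_unique h1 h2
  have hwM : w0 (M, θ) = 0 := by
    refine hz (fun x => w0 (x, θ)) h0s.continuous ?_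
    intro q hq
    have : (fun s => F0 φ0 φ1 s θ) =ᶠ[𝓝 q] fun _ => 0 := by
      filter_upwards [Ioi_mem_nhds hq] with x hx
      rw [← hin]; exact hsupp x θ 0 hx
    show deriv (fun s => F0 φ0 φ1 s θ) q = 0
    rw [this.deriv_eq]; simp
  have hVq : ∀ q τ, 0 ≤ τ → τ < T →
      HasDerivAt (fun q => V q θ τ) (DW T (1, 0, 0) f (q, θ, τ)) q := fun q τ h0 hT => DW_q hfs q θ τ h0 hT
  have hVM : ∀ τ, 0 ≤ τ → τ < T → V M θ τ = 0 := by
    intro τ h0 hT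
    refine hz (fun q => V q θ τ) ?_ (fun q hq => hsupp q θ τ hq)
    exact continuous_iff_continuousAt.2 fun q => (hVq q τ h0 hT).continuousAt
  set W : ℝ × ℝ × ℝ → ℝ := DW T (1, 0, 0) f with hW
  have hWs : ContDiffOn ℝ (⊤ : ℕ∞) W (slab T) := DW_smooth _ hfs
  have hcont : ∀ G : ℝ × ℝ × ℝ → ℝ, ContDiffOn ℝ (⊤ : ℕ∞) G (slab T) →
      ContinuousOn (fun p : ℝ × ℝ => G (p.1, θ, p.2)) {p | 0 ≤ p.2 ∧ p.2 < T} := by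
    intro G hG
    exact hG.continuousOn.comp (f := fun p : ℝ × ℝ => (p.1, θ, p.2)) (by fun_prop) (fun p hp => hp)
  have hid : ∀ s, s ≤ M → W (QQ M (dhat d θ) (ehat e θ) (fun x => w0 (x, θ)) (fun x => w1 (x, θ)) s τ, θ, τ)
      = w0 (s, θ) := by
    intro s hs
    refine char_identity T M (dhat d θ) (ehat e θ) (fun q τ => V q θ τ) (fun q τ => W (q, θ, τ))
      (fun q τ => DW T (1, 0, 0) W (q, θ, τ)) (fun q τ => DW T (0, 0, 1) W (q, θ, τ))
      (fun x => w0 (x, θ)) (fun x => w1 (x, θ)) h0s h1s (fun s => hd1 s θ) hwM hVq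
      (hcont W hWs) (hcont _ (DW_smooth _ hWs)) ?_ ?_ hVM ?_ s τ hs h0 hτ
    · intro q q' τ h0 hT hq
      have := DW_curve hWs (A := Set.Ioo 0 T) (t := τ) (x := q) (y := fun _ => θ) (z := fun t => t)
        ⟨h0, hT⟩ (fun t ht => ⟨ht.1.le, ht.2⟩) hq.hasDerivWithinAt (hasDerivWithinAt_const _ _ _)
        (hasDerivWithinAt_id τ _)
      refine HasDerivAt.congr_deriv (this.hasDerivAt (Ioo_mem_nhds h0 hT)) ?_
      ring
    · intro q τ h0 hT
      have hq1 : ∀ x t, 0 ≤ t → t < T → deriv (fun q' => V q' θ t) x = W (x, θ, t) :=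
        fun x t h1 h2 => (hVq x t h1 h2).deriv
      have hp := hpde q θ τ h0.le hT
      have e1 : deriv (fun τ' => deriv (fun q' => V q' θ τ') q) τ = DW T (0, 0, 1) W (q, θ, τ) := by
        have : (fun τ' => deriv (fun q' => V q' θ τ') q) =ᶠ[𝓝 τ] fun t => W (q, θ, t) := by
          filter_upwards [Ioo_mem_nhds h0 hT] with t ht
          exact hq1 q t ht.1.le ht.2
        rw [this.deriv_eq]
        exact ((DW_tau hWs q θ τ h0.le hT).hasDerivAt (Ico_mem_nhds h0 hT)).deriv
      have e2 : deriv (fun q' => deriv (fun q'' => V q'' θ τ) q') q = DW T (1, 0, 0) W (q, θ, τ) := by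
        have : (fun q' => deriv (fun q'' => V q'' θ τ) q') = fun x => W (x, θ, τ) := by
          funext x; exact hq1 x τ h0.le hT
        rw [this]
        exact (DW_q hWs q θ τ h0.le hT).deriv
      rw [e1, e2, hq1 q τ h0.le hT] at hp
      show DW T (0, 0, 1) W (q, θ, τ) = (dhat d θ * V q θ τ + ehat e θ * W (q, θ, τ)) * DW T (1, 0, 0) W (q, θ, τ)
      unfold dhat ehat
      simp only [Fin.sum_univ_three] at hp ⊢
      linear_combination hp
    · intro q
      have h1 := hVq q 0 le_rfl hT
      have h2 : (fun q => V q θ 0) = fun q => F0 φ0 φ1 q θ := by funext x; exact hin x θ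
      rw [h2] at h1
      exact h1.unique (hd0 q θ)
  exact char_V T M (dhat d θ) (ehat e θ) (fun q τ => V q θ τ) (fun q τ => W (q, θ, τ))
    (fun x => w0 (x, θ)) (fun x => w1 (x, θ)) h0s h1s hVq hVM s τ hs h0 hτ hid

end

section

theorem sρ_deriv (c x : ℝ) (hx : 0 < x) :
    HasDerivAt (fun x : ℝ => c - (x ^ 2)⁻¹) (2 * (x ^ 3)⁻¹) x := by
  have h1 : HasDerivAt (fun x : ℝ => x ^ 2) (2 * x) x := by
    simpa using hasDerivAt_pow 2 x
  refine HasDerivAt.congr_deriv ((h1.inv (by positivity)).const_sub c) ?_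
  field_simp

/-- factorization of the derivative in the compactified variable. -/
theorem compact_step {c : ℝ} {w w' g g' : ℝ → ℝ} (hw : ∀ s, HasDerivAt w (w' s) s)
    (hg : ∀ x, HasDerivAt g (g' x) x) (h : ∀ x, 0 < x → w (c - (x ^ 2)⁻¹) = g x) (x : ℝ) (hx : 0 < x) :
    w' (c - (x ^ 2)⁻¹) = x ^ 3 * (g' x / 2) := by
  have h1 := (hw (c - (x ^ 2)⁻¹)).comp x (sρ_deriv c x hx)
  have h2 : HasDerivAt (w ∘ fun x : ℝ => c - (x ^ 2)⁻¹) (g' x) x := by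
    refine (hg x).congr_of_eventuallyEq ?_
    filter_upwards [Ioi_mem_nhds hx] with y hy
    exact h y hy
  have h3 := h1.unique h2
  rw [← h3]
  field_simp

theorem flow_exists (M : ℝ) (hM : 0 < M)
    (φ0 φ1 : ℝ × ℝ → ℝ)
    (hφ0 : ContDiff ℝ (⊤ : ℕ∞) φ0) (hφ1 : ContDiff ℝ (⊤ : ℕ∞) φ1)
    (hs0 : SuppIn M φ0) (hs1 : SuppIn M φ1)
    (d : Fin 3 → Fin 3 → ℝ) (e : Fin 3 → Fin 3 → Fin 3 → ℝ) (T : ℝ) (hT : 0 < T)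
    (V : ℝ → ℝ → ℝ → ℝ) (hV : IsProfileSol M d e φ0 φ1 T V) :
    ∃ N h : ℝ × ℝ × ℝ → ℝ, ContDiff ℝ (⊤ : ℕ∞) h ∧ ContDiff ℝ (⊤ : ℕ∞) N ∧
      (∀ ρ θ τ, HasDerivAt (fun x => N (x, θ, τ)) (2 * h (ρ, θ, τ)) ρ) ∧
      FlowRep T (-2 * M) N h 0 (fun p : ℝ × ℝ × ℝ => V p.1 p.2.1 p.2.2) := by
  obtain ⟨w0, w1, hw0, hw1, hd0, hd1, hchar⟩ := prof_char M d e φ0 φ1 T hT V hV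
  obtain ⟨f, hf, hF⟩ := F0_compact M hM φ0 φ1 hφ0 hφ1 hs0 hs1
  set g0 : ℝ × ℝ → ℝ := fun p => deriv (fun s => f (s, p.2)) p.1 / 2 with hg0
  have hg0s : ContDiff ℝ (⊤ : ℕ∞) g0 := (smooth_pd1 hf).div_const 2
  have hw0g : ∀ x θ, 0 < x → w0 (-2 * M - (x ^ 2)⁻¹, θ) = x ^ 3 * g0 (x, θ) := fun x θ hx =>
    compact_step (w := fun s => F0 φ0 φ1 s θ) (w' := fun s => w0 (s, θ)) (g := fun x => f (x, θ))
      (g' := fun x => deriv (fun s => f (s, θ)) x) (fun s => hd0 s θ) (fun x => pd1_hasDerivAt hf x θ)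
      (fun x hx => hF x θ hx) x hx
  set g0' : ℝ × ℝ → ℝ := fun p => deriv (fun s => g0 (s, p.2)) p.1 with hg0'
  have hg0's : ContDiff ℝ (⊤ : ℕ∞) g0' := smooth_pd1 hg0s
  set g1 : ℝ × ℝ → ℝ := fun p => (3 * p.1 ^ 2 * g0 p + p.1 ^ 3 * g0' p) / 2 with hg1
  have hg1s : ContDiff ℝ (⊤ : ℕ∞) g1 := by rw [hg1]; fun_prop
  have hw1g : ∀ x θ, 0 < x → w1 (-2 * M - (x ^ 2)⁻¹, θ) = x ^ 3 * g1 (x, θ) := fun x θ hx =>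
    compact_step (w := fun s => w0 (s, θ)) (w' := fun s => w1 (s, θ)) (g := fun x => x ^ 3 * g0 (x, θ))
      (g' := fun x => 3 * x ^ 2 * g0 (x, θ) + x ^ 3 * g0' (x, θ)) (fun s => hd1 s θ)
      (fun x => by
        have h1 : HasDerivAt (fun x : ℝ => x ^ 3) (3 * x ^ 2) x := by simpa using hasDerivAt_pow 3 x
        exact h1.mul (pd1_hasDerivAt hg0s x θ))
      (fun x hx => hw0g x θ hx) x hx
  have hdh := dhat_smooth d
  have heh := ehat_smooth e
  have hdh3 : ContDiff ℝ (⊤ : ℕ∞) (fun p : ℝ × ℝ × ℝ => dhat d p.2.1) :=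
    hdh.comp (by fun_prop : ContDiff ℝ (⊤ : ℕ∞) fun p : ℝ × ℝ × ℝ => p.2.1)
  have heh3 : ContDiff ℝ (⊤ : ℕ∞) (fun p : ℝ × ℝ × ℝ => ehat e p.2.1) :=
    heh.comp (by fun_prop : ContDiff ℝ (⊤ : ℕ∞) fun p : ℝ × ℝ × ℝ => p.2.1)
  have lift2 : ∀ g : ℝ × ℝ → ℝ, ContDiff ℝ (⊤ : ℕ∞) g →
      ContDiff ℝ (⊤ : ℕ∞) (fun p : ℝ × ℝ × ℝ => g (p.1, p.2.1)) := fun g hg =>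
    hg.comp (by fun_prop : ContDiff ℝ (⊤ : ℕ∞) fun p : ℝ × ℝ × ℝ => (p.1, p.2.1))
  have hg03 := lift2 g0 hg0s
  have hg13 := lift2 g1 hg1s
  have hw03 := lift2 w0 hw0
  have hw13 := lift2 w1 hw1
  set h : ℝ × ℝ × ℝ → ℝ := fun p => -((dhat d p.2.1 * g0 (p.1, p.2.1) + ehat e p.2.1 * g1 (p.1, p.2.1)) *
    JJ (dhat d p.2.1 * (p.1 ^ 3 * g0 (p.1, p.2.1))) p.2.2) with hh
  have hhs : ContDiff ℝ (⊤ : ℕ∞) h := by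
    have hJ : ContDiff ℝ (⊤ : ℕ∞) (fun p : ℝ × ℝ × ℝ => JJ (dhat d p.2.1 * (p.1 ^ 3 * g0 (p.1, p.2.1))) p.2.2) :=
      JJ_smooth.comp (f := fun p : ℝ × ℝ × ℝ => (dhat d p.2.1 * (p.1 ^ 3 * g0 (p.1, p.2.1)), p.2.2))
        (by fun_prop)
    rw [hh]; fun_prop
  -- the jacobian
  set K : ℝ × ℝ × ℝ → ℝ := fun p => kk (dhat d p.2.1) (ehat e p.2.1) (fun x => w0 (x, p.2.1))
    (fun x => w1 (x, p.2.1)) p.1 p.2.2 with hK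
  have hKs : ContDiff ℝ (⊤ : ℕ∞) K := by
    have hJ : ContDiff ℝ (⊤ : ℕ∞) (fun p : ℝ × ℝ × ℝ => JJ (dhat d p.2.1 * w0 (p.1, p.2.1)) p.2.2) :=
      JJ_smooth.comp (f := fun p : ℝ × ℝ × ℝ => (dhat d p.2.1 * w0 (p.1, p.2.1), p.2.2))
        (by fun_prop)
    rw [hK]; unfold kk; fun_prop
  have hKh : ∀ x θ τ, 0 < x → K (-2 * M - (x ^ 2)⁻¹, θ, τ) = kh h (x, θ, τ) := by
    intro x θ τ hx
    simp only [hK, kk, kh, hh]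
    rw [hw0g x θ hx, hw1g x θ hx]
    ring
  have hKc : ∀ θ τ, Continuous (fun s => K (s, θ, τ)) := fun θ τ =>
    hKs.continuous.comp (by fun_prop : Continuous fun s : ℝ => (s, θ, τ))
  have hw0c : ∀ θ, Continuous (fun s => w0 (s, θ)) := fun θ =>
    hw0.continuous.comp (by fun_prop : Continuous fun s : ℝ => (s, θ))
  -- antiderivatives
  have anti : ∀ u : ℝ × ℝ × ℝ → ℝ, ContDiff ℝ (⊤ : ℕ∞) u →
      ContDiff ℝ (⊤ : ℕ∞) (fun p : ℝ × ℝ × ℝ => ∫ x in (1:ℝ)..p.1, u (x, p.2.1, p.2.2)) := by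
    intro u hu
    exact pi_contDiff_var (fun p : (ℝ × ℝ × ℝ) × ℝ => u (p.2, p.1.2.1, p.1.2.2))
      (hu.comp (by fun_prop : ContDiff ℝ (⊤ : ℕ∞) fun p : (ℝ × ℝ × ℝ) × ℝ => (p.2, p.1.2.1, p.1.2.2)))
      (fun _ => 1) (fun p => p.1) contDiff_const contDiff_fst
  have base : ∀ u : ℝ × ℝ × ℝ → ℝ, ContDiff ℝ (⊤ : ℕ∞) u →
      ContDiff ℝ (⊤ : ℕ∞) (fun p : ℝ × ℝ × ℝ => ∫ x in (-2 * M - 1)..M, u (x, p.2.1, p.2.2)) := by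
    intro u hu
    exact pi_contDiff (fun p : (ℝ × ℝ × ℝ) × ℝ => u (p.2, p.1.2.1, p.1.2.2))
      (hu.comp (by fun_prop : ContDiff ℝ (⊤ : ℕ∞) fun p : (ℝ × ℝ × ℝ) × ℝ => (p.2, p.1.2.1, p.1.2.2)))
      _ _
  -- generic change of variables
  have cov : ∀ (A : ℝ → ℝ) (a b : ℝ → ℝ), Continuous b →
      (∀ s, HasDerivAt A (a s) s) → (∀ x, 0 < x → a (-2 * M - (x ^ 2)⁻¹) = x ^ 3 * b x) → ∀ ρ, 0 < ρ →
      A (-2 * M - (ρ ^ 2)⁻¹) = A (-2 * M - 1) + ∫ x in (1:ℝ)..ρ, 2 * b x := by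
    intro A a b hb hA hab ρ hρ
    have hpos : ∀ x ∈ Set.uIcc 1 ρ, 0 < x := fun x hx =>
      lt_of_lt_of_le (lt_min one_pos hρ) hx.1
    have := intervalIntegral.integral_eq_sub_of_hasDerivAt (a := 1) (b := ρ)
      (f := fun x => A (-2 * M - (x ^ 2)⁻¹)) (f' := fun x => 2 * b x)
      (fun x hx => by
        have hx0 := hpos x hx
        refine HasDerivAt.congr_deriv ((hA _).comp x (sρ_deriv (-2 * M) x hx0)) ?_
        rw [hab x hx0]; field_simp)
      ((by fun_prop : Continuous fun x => 2 * b x).intervalIntegrable _ _)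
    rw [this]; simp
  set N : ℝ × ℝ × ℝ → ℝ := fun p => (M - ∫ x in (-2 * M - 1)..M, K (x, p.2.1, p.2.2)) + 2 * M + 1 +
    ∫ x in (1:ℝ)..p.1, 2 * h (x, p.2.1, p.2.2) with hN
  have hNs : ContDiff ℝ (⊤ : ℕ∞) N := by
    have h1 := base K hKs
    have h2 := anti (fun p => 2 * h p) (by fun_prop)
    rw [hN]; fun_prop
  set v : ℝ × ℝ × ℝ → ℝ := fun p => (- ∫ x in (-2 * M - 1)..M, w0 (x, p.2.1) * K (x, p.2.1, p.2.2)) +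
    ∫ x in (1:ℝ)..p.1, 2 * (g0 (x, p.2.1) * kh h (x, p.2.1, p.2.2)) with hv
  have hkhs := kh_smooth hhs
  have hvs : ContDiff ℝ (⊤ : ℕ∞) v := by
    have h1 := base (fun p => w0 (p.1, p.2.1) * K p) (by fun_prop)
    have h2 := anti (fun p => 2 * (g0 (p.1, p.2.1) * kh h p)) (by fun_prop)
    rw [hv]; exact h1.neg.add h2
  have hhc : ∀ θ τ, Continuous (fun x => h (x, θ, τ)) := fun θ τ =>
    hhs.continuous.comp (by fun_prop : Continuous fun s : ℝ => (s, θ, τ))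
  have hkhc : ∀ θ τ, Continuous (fun x => kh h (x, θ, τ)) := fun θ τ =>
    hkhs.continuous.comp (by fun_prop : Continuous fun s : ℝ => (s, θ, τ))
  have hg0c : ∀ θ, Continuous (fun s => g0 (s, θ)) := fun θ =>
    hg0s.continuous.comp (by fun_prop : Continuous fun s : ℝ => (s, θ))
  refine ⟨N, h, hhs, hNs, ?_, v, hvs.contDiffOn, ?_⟩
  · intro ρ θ τ
    have hc : Continuous (fun x => 2 * h (x, θ, τ)) := continuous_const.mul (hhc θ τ)
    exact (intervalIntegral.integral_hasDerivAt_right (hc.intervalIntegrable 1 ρ)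
      (hc.stronglyMeasurableAtFilter _ _) hc.continuousAt).const_add
        ((M - ∫ x in (-2 * M - 1)..M, K (x, θ, τ)) + 2 * M + 1)
  · intro ρ θ τ hρ h0 hτ _
    have hQ : QQ M (dhat d θ) (ehat e θ) (fun x => w0 (x, θ)) (fun x => w1 (x, θ)) (-2 * M - (ρ ^ 2)⁻¹) τ
        = -2 * M - (ρ ^ 2)⁻¹ + N (ρ, θ, τ) := by
      have h1 := cov (fun s => QQ M (dhat d θ) (ehat e θ) (fun x => w0 (x, θ)) (fun x => w1 (x, θ)) s τ - s)
        (fun s => K (s, θ, τ) - 1) (fun x => h (x, θ, τ)) (hhc θ τ)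
        (fun s => (QQ_deriv_s M _ _ (fun x => w0 (x, θ)) (fun x => w1 (x, θ))
          (hw0.comp (by fun_prop : ContDiff ℝ (⊤ : ℕ∞) fun x : ℝ => (x, θ)))
          (hw1.comp (by fun_prop : ContDiff ℝ (⊤ : ℕ∞) fun x : ℝ => (x, θ))) s τ).sub (hasDerivAt_id s))
        (fun x hx => by rw [hKh x θ τ hx]; simp [kh]) ρ hρ
      have h2 : QQ M (dhat d θ) (ehat e θ) (fun x => w0 (x, θ)) (fun x => w1 (x, θ)) (-2 * M - 1) τ
        = M - ∫ x in (-2 * M - 1)..M, K (x, θ, τ) := rfl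
      rw [h2] at h1
      simp only [hN]
      linarith
    have hle : -2 * M - (ρ ^ 2)⁻¹ ≤ M := by
      have : 0 < (ρ ^ 2)⁻¹ := by positivity
      linarith
    have hcv := hchar _ θ τ hle h0 hτ
    rw [hQ] at hcv
    have hI := cov (fun s => - ∫ s' in s..M, w0 (s', θ) * K (s', θ, τ))
      (fun s => w0 (s, θ) * K (s, θ, τ)) (fun x => g0 (x, θ) * kh h (x, θ, τ)) ((hg0c θ).mul (hkhc θ τ))
      (fun s => by
        have hc : Continuous (fun s => w0 (s, θ) * K (s, θ, τ)) := (hw0c θ).mul (hKc θ τ)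
        have := (intervalIntegral.integral_hasDerivAt_left (hc.intervalIntegrable s M)
          (hc.stronglyMeasurableAtFilter _ _) hc.continuousAt).neg
        exact HasDerivAt.congr_deriv this (by ring))
      (fun x hx => by rw [hKh x θ τ hx, hw0g x θ hx]; ring) ρ hρ
    show V (-2 * M - (ρ ^ 2)⁻¹ + N (ρ, θ, τ)) θ τ = ρ ^ 0 * v (ρ, θ, τ)
    rw [hcv, pow_zero, one_mul]
    exact hI

theorem main_thm
    (M : ℝ) (hM : 0 < M)
    (φ0 φ1 : ℝ × ℝ → ℝ)
    (hφ0 : ContDiff ℝ (⊤ : ℕ∞) φ0) (hφ1 : ContDiff ℝ (⊤ : ℕ∞) φ1)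
    (hs0 : SuppIn M φ0) (hs1 : SuppIn M φ1)
    (d : Fin 3 → Fin 3 → ℝ)
    (e : Fin 3 → Fin 3 → Fin 3 → ℝ)
    (V : ℝ → ℝ → ℝ → ℝ)
    (hV : IsProfileSol M d e φ0 φ1 (tau0 M d e φ0 φ1) V) :
    ∀ b : ℝ, 0 < b → b < tau0 M d e φ0 φ1 → ∀ m a l : ℕ,
      (∃ C : ℝ, ∀ q θ τ : ℝ, 0 ≤ τ → τ ≤ b →
        |mderiv (m + 1) a l V q θ τ| ≤ C * (1 + |q|) ^ (-(3 : ℝ) / 2 - (m : ℝ))) ∧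
      (∃ C : ℝ, ∀ q θ τ : ℝ, 0 ≤ τ → τ ≤ b →
        |mderiv 0 a l V q θ τ| ≤ C) := by
  intro b hb hbT m a l
  obtain ⟨N, h, hh, hN, hNρ, hr⟩ := flow_exists M hM φ0 φ1 hφ0 hφ1 hs0 hs1 d e _ (hb.trans hbT) V hV
  have hVs : ContDiffOn ℝ (⊤ : ℕ∞) (fun p : ℝ × ℝ × ℝ => V p.1 p.2.1 p.2.2) (slab (tau0 M d e φ0 φ1)) := hV.1
  constructor
  · obtain ⟨C, hC⟩ := mderiv_bound V hVs hV.2.2.1 hV.2.1 hh hN (m + 1) a l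
      (rep_GG hh hN hNρ hVs hr m a l) hb hbT
    refine ⟨C, fun q θ τ h0 hτ => ?_⟩
    have := hC q θ τ h0 hτ
    have he : -(((3 + 2 * m : ℕ) : ℝ) / 2) = -(3 : ℝ) / 2 - (m : ℝ) := by push_cast; ring
    rw [he] at this
    exact this
  · obtain ⟨C, hC⟩ := mderiv_bound V hVs hV.2.2.1 hV.2.1 hh hN 0 a l
      (rep_GG0 hh hN hNρ hVs hr a l) hb hbT
    refine ⟨C, fun q θ τ h0 hτ => ?_⟩
    have := hC q θ τ h0 hτ
    simpa using this

end

/-- Decay estimates (2.8) for the profile `V` on `0 ≤ τ ≤ b < τ₀`. -/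
theorem profile_decay_estimates
    (M : ℝ) (hM : 0 < M)
    (φ0 φ1 : ℝ × ℝ → ℝ)
    (hφ0 : ContDiff ℝ (⊤ : ℕ∞) φ0) (hφ1 : ContDiff ℝ (⊤ : ℕ∞) φ1)
    (hs0 : SuppIn M φ0) (hs1 : SuppIn M φ1)
    (d : Fin 3 → Fin 3 → ℝ)
    (hdsymm : ∀ i j, d i j = d j i) (hd00 : d 0 0 = 0)
    (hdne : ∃ i j : Fin 3, (i, j) ≠ ((0 : Fin 3), (0 : Fin 3)) ∧ d i j ≠ 0)
    (e : Fin 3 → Fin 3 → Fin 3 → ℝ)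
    (hnull : NullCondFails e)
    (hne : φ0 ≠ 0 ∨ φ1 ≠ 0)
    (V : ℝ → ℝ → ℝ → ℝ)
    (hV : IsProfileSol M d e φ0 φ1 (tau0 M d e φ0 φ1) V) :
    ∀ b : ℝ, 0 < b → b < tau0 M d e φ0 φ1 → ∀ m a l : ℕ,
      (∃ C : ℝ, ∀ q θ τ : ℝ, 0 ≤ τ → τ ≤ b →
        |mderiv (m + 1) a l V q θ τ| ≤ C * (1 + |q|) ^ (-(3 : ℝ) / 2 - (m : ℝ))) ∧
      (∃ C : ℝ, ∀ q θ τ : ℝ, 0 ≤ τ → τ ≤ b →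
        |mderiv 0 a l V q θ τ| ≤ C) := by
  exact main_thm M hM φ0 φ1 hφ0 hφ1 hs0 hs1 d e V hV
end

section
/- Let M > 0. There exists a constant C > 0 depending only on M such that for every f ∈ C¹([0,∞)×ℝ²) with supp f ⊆ {(t,x) : |x| ≤ M + t} and every t ≥ 0, ‖(1+|t−r|)^{−1} f(t,·)‖_{L²(ℝ²)} ≤ C ‖∂_r f(t,·)‖_{L²(ℝ²)}, where r = |x| and ∂_r f = (x/|x|)·∇_x f. -/
open Real MeasureTheory Filter Topology Asymptotics

lemma wp_oneD (M t : ℝ) (hM : 0 < M) (ht : 0 ≤ t) (h D : ℝ → ℝ)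
    (hd : ∀ r, HasDerivAt h (D r) r) (hD : Continuous D) (h0 : h (M + t) = 0) :
    0 ≤ ∫ r in (0:ℝ)..(M + t),
      ((2 * (1 + M)) ^ 2 * (r * D r ^ 2) - r * ((1 + |t - r|)⁻¹ * h r) ^ 2) := by
  have hR : 0 ≤ M + t := by linarith
  have hh : Continuous h := continuous_iff_continuousAt.2 fun r => (hd r).continuousAt
  have hs : ∀ r ∈ Set.uIcc 0 (M + t), 0 < 1 + (M + t) - r := by
    intro r hr
    rw [Set.uIcc_of_le hR] at hr
    linarith [hr.2]
  set E : ℝ → ℝ := fun r =>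
    ((1 + (M + t)) / (1 + (M + t) - r) ^ 2 * h r ^ 2 +
      r / (1 + (M + t) - r) * (2 * h r * D r)) with hE
  have hEc : ContinuousOn E (Set.uIcc 0 (M + t)) := by
    refine ContinuousOn.add (ContinuousOn.mul (ContinuousOn.div (by fun_prop) (by fun_prop) ?_)
      (by fun_prop)) (ContinuousOn.mul (ContinuousOn.div (by fun_prop) (by fun_prop) ?_)
      (by fun_prop))
    · intro r hr
      have := hs r hr
      positivity
    · intro r hr
      exact (hs r hr).ne'
  have hEI : ∫ r in (0:ℝ)..(M + t), E r = 0 := by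
    rw [intervalIntegral.integral_eq_sub_of_hasDerivAt
      (f := fun r => r / (1 + (M + t) - r) * h r ^ 2) (f' := E) _ hEc.intervalIntegrable]
    · simp [h0]
    · intro r hr
      have hp := (hs r hr).ne'
      have h1 : HasDerivAt (fun r : ℝ => 1 + (M + t) - r) (-1) r := by
        simpa using (hasDerivAt_id r).const_sub (1 + (M + t))
      have h2 := ((hasDerivAt_id r).div h1 hp).mul ((hd r).pow 2)
      refine h2.congr_deriv ?_
      simp only [hE, id, Pi.pow_apply, Pi.div_apply]
      field_simp
      push_cast
      ring_nf
  have : -(2 * (1 + M) ^ 2) * ∫ r in (0:ℝ)..(M + t), E r ≤ ∫ r in (0:ℝ)..(M + t),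
      ((2 * (1 + M)) ^ 2 * (r * D r ^ 2) - r * ((1 + |t - r|)⁻¹ * h r) ^ 2) := by
    rw [← intervalIntegral.integral_const_mul]
    apply intervalIntegral.integral_mono_on hR
    · exact hEc.intervalIntegrable.const_mul _
    · apply Continuous.intervalIntegrable
      have : Continuous fun r : ℝ => (1 + |t - r|)⁻¹ := by
        refine Continuous.inv₀ (by fun_prop) fun r => ?_
        positivity
      fun_prop
    · intro r hr
      have hsr := hs r (by rwa [Set.uIcc_of_le hR])
      have hcmp : 1 + (M + t) - r ≤ (1 + M) * (1 + |t - r|) := by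
        have h1 := le_abs_self (t - r)
        have h2 := abs_nonneg (t - r)
        nlinarith
      have hW : (1 + |t - r|)⁻¹ ≤ (1 + M) / (1 + (M + t) - r) := by
        rw [inv_eq_one_div, div_le_div_iff₀ (by positivity) hsr]
        linarith
      have hW2 : r * ((1 + |t - r|)⁻¹ * h r) ^ 2 ≤
          r * ((1 + M) / (1 + (M + t) - r) * h r) ^ 2 := by
        rw [mul_pow, mul_pow]
        have := hr.1
        gcongr
      have key : (2 * (1 + M)) ^ 2 * (r * D r ^ 2) -
          r * ((1 + M) / (1 + (M + t) - r) * h r) ^ 2 + 2 * (1 + M) ^ 2 * E r =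
          (1 + M) ^ 2 * (r * (2 * D r + h r / (1 + (M + t) - r)) ^ 2 +
            2 * (h r ^ 2 / (1 + (M + t) - r))) := by
        simp only [hE]
        field_simp
        ring
      have : 0 ≤ (1 + M) ^ 2 * (r * (2 * D r + h r / (1 + (M + t) - r)) ^ 2 +
            2 * (h r ^ 2 / (1 + (M + t) - r))) := by
        have := hr.1
        positivity
      linarith
  rw [hEI] at this
  linarith

lemma wp_deriv (f : (Fin 3 → ℝ) → ℝ) (hf : ContDiff ℝ 1 f) (t c s r : ℝ) :
    HasDerivAt (fun r : ℝ => f ![t, r * c, r * s])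
      (c * pd 1 f ![t, r * c, r * s] + s * pd 2 f ![t, r * c, r * s]) r := by
  have hl : HasDerivAt (fun r : ℝ => ![t, r * c, r * s]) ![0, c, s] r := by
    rw [hasDerivAt_pi]
    intro i
    fin_cases i
    · simpa using hasDerivAt_const r t
    · simpa using (hasDerivAt_id r).mul_const c
    · simpa using (hasDerivAt_id r).mul_const s
  have h1 := ((hf.differentiable one_ne_zero) ![t, r * c, r * s]).hasFDerivAt.comp_hasDerivAt r hl
  refine h1.congr_deriv ?_
  have : (![0, c, s] : Fin 3 → ℝ) = c • Pi.single 1 1 + s • Pi.single 2 1 := by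
    ext i
    fin_cases i <;> simp
  rw [this, map_add, map_smul, map_smul]
  rfl

lemma wp_cont (f : (Fin 3 → ℝ) → ℝ) (hf : ContDiff ℝ 1 f) (i : Fin 3) : Continuous (pd i f) :=
  (hf.continuous_fderiv one_ne_zero).clm_apply continuous_const

lemma wp_polar (R : ℝ) (G : ℝ × ℝ → ℝ) (H : ℝ × ℝ → ℝ)
    (hGH : ∀ p ∈ polarCoord.target, p.1 • G (polarCoord.symm p) = H p)
    (h0 : ∀ p : ℝ × ℝ, R < p.1 → H p = 0) :
    ∫ x, G x = ∫ p in Set.Ioc 0 R ×ˢ Set.Ioo (-π) π, H p := by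
  rw [← integral_comp_polarCoord_symm]
  rw [setIntegral_congr_fun polarCoord.open_target.measurableSet hGH]
  rw [polarCoord_target]
  apply setIntegral_eq_of_subset_of_forall_sdiff_eq_zero
  · exact measurableSet_Ioi.prod measurableSet_Ioo
  · exact Set.prod_mono Set.Ioc_subset_Ioi_self le_rfl
  · rintro p ⟨hp1, hp2⟩
    apply h0
    by_contra hcon
    exact hp2 ⟨⟨hp1.1, not_lt.1 hcon⟩, hp1.2⟩

lemma wp_int (R : ℝ) (H : ℝ × ℝ → ℝ) (hH : Continuous H) :
    IntegrableOn H (Set.Ioc 0 R ×ˢ Set.Ioo (-π) π) :=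
  (hH.continuousOn.integrableOn_compact
    (isCompact_Icc.prod isCompact_Icc : IsCompact (Set.Icc 0 R ×ˢ Set.Icc (-π) π))).mono_set
    (Set.prod_mono Set.Ioc_subset_Icc_self Set.Ioo_subset_Icc_self)

/-- Lemma 2.5: for `f ∈ C¹` with `supp f ⊆ {r ≤ M + t}`,
`‖(1+|t−r|)⁻¹ f(t,·)‖_{L²} ≤ C ‖∂_r f(t,·)‖_{L²}` with `C` depending only on `M`. -/
theorem weighted_poincare_inequality (M : ℝ) (hM : 0 < M) :
    ∃ C : ℝ, 0 < C ∧
      ∀ f : (Fin 3 → ℝ) → ℝ, ContDiff ℝ 1 f →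
        (∀ y : Fin 3 → ℝ, 0 ≤ y 0 → (M + y 0) ^ 2 < (y 1) ^ 2 + (y 2) ^ 2 →
          f y = 0) →
        ∀ t : ℝ, 0 ≤ t →
          ∫ x : ℝ × ℝ,
              ((1 + |t - Real.sqrt (x.1 ^ 2 + x.2 ^ 2)|)⁻¹ * f ![t, x.1, x.2]) ^ 2
            ≤ C ^ 2 *
              ∫ x : ℝ × ℝ,
                ((x.1 * pd 1 f ![t, x.1, x.2] + x.2 * pd 2 f ![t, x.1, x.2]) /
                    Real.sqrt (x.1 ^ 2 + x.2 ^ 2)) ^ 2 := by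
  refine ⟨2 * (1 + M), by positivity, ?_⟩
  intro f hf hsupp t ht
  have hR : 0 ≤ M + t := by linarith
  have hfc := hf.continuous
  have hc1 := wp_cont f hf 1
  have hc2 := wp_cont f hf 2
  have hz : ∀ θ r : ℝ, M + t < r → f ![t, r * cos θ, r * sin θ] = 0 := by
    intro θ r hr
    apply hsupp _ (by simpa using ht)
    have : (r * cos θ) ^ 2 + (r * sin θ) ^ 2 = r ^ 2 := by
      linear_combination r ^ 2 * (Real.sin_sq_add_cos_sq θ)
    simp only [Matrix.cons_val_zero, Matrix.cons_val_one, Matrix.cons_val]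
    rw [this]
    exact pow_lt_pow_left₀ hr hR two_ne_zero
  have hsqrt : ∀ r θ : ℝ, 0 < r → √((r * cos θ) ^ 2 + (r * sin θ) ^ 2) = r := by
    intro r θ hr
    have : (r * cos θ) ^ 2 + (r * sin θ) ^ 2 = r ^ 2 := by
      linear_combination r ^ 2 * (Real.sin_sq_add_cos_sq θ)
    rw [this, Real.sqrt_sq hr.le]
  set D : ℝ → ℝ → ℝ := fun θ r => cos θ * pd 1 f ![t, r * cos θ, r * sin θ] +
    sin θ * pd 2 f ![t, r * cos θ, r * sin θ] with hDdef
  have hder : ∀ θ r, HasDerivAt (fun r : ℝ => f ![t, r * cos θ, r * sin θ]) (D θ r) r :=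
    fun θ r => wp_deriv f hf t _ _ r
  have hDz : ∀ θ r : ℝ, M + t < r → D θ r = 0 := by
    intro θ r hr
    refine (hder θ r).unique ?_
    refine (hasDerivAt_const r (0:ℝ)).congr_of_eventuallyEq ?_
    filter_upwards [Ioi_mem_nhds hr] with r' hr'
    exact hz θ r' hr'
  have hvec : Continuous fun p : ℝ × ℝ => (![t, p.1 * cos p.2, p.1 * sin p.2] : Fin 3 → ℝ) := by
    refine continuous_pi fun i => ?_
    fin_cases i
    · simpa using continuous_const
    · simp; fun_prop
    · simp; fun_prop
  have hDc : Continuous fun p : ℝ × ℝ => D p.2 p.1 := by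
    have e1 := hc1.comp hvec
    have e2 := hc2.comp hvec
    simp only [Function.comp_def] at e1 e2
    simp only [hDdef]
    fun_prop
  have hhc : Continuous fun p : ℝ × ℝ => f ![t, p.1 * cos p.2, p.1 * sin p.2] := hfc.comp hvec
  have hWc : Continuous fun p : ℝ × ℝ => (1 + |t - p.1|)⁻¹ := by
    refine Continuous.inv₀ (by fun_prop) fun r => ?_
    positivity
  rw [wp_polar (M + t) _ (fun p => p.1 * ((1 + |t - p.1|)⁻¹ *
      f ![t, p.1 * cos p.2, p.1 * sin p.2]) ^ 2),
    wp_polar (M + t) _ (fun p => p.1 * (D p.2 p.1) ^ 2)]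
  · rw [← integral_const_mul, ← sub_nonneg, ← integral_sub]
    · rw [Measure.volume_eq_prod, ← Measure.prod_restrict, integral_prod_symm]
      · refine integral_nonneg fun θ => ?_
        have := wp_oneD M t hM ht (fun r : ℝ => f ![t, r * cos θ, r * sin θ]) (D θ) (hder θ)
          (hDc.comp (by fun_prop : Continuous fun r : ℝ => (r, θ))) ?_
        · rw [intervalIntegral.integral_of_le hR] at this
          exact this
        · have hcl : Continuous fun r : ℝ => f ![t, r * cos θ, r * sin θ] :=
            continuous_iff_continuousAt.2 fun r => (hder θ r).continuousAt
          have h1 : Tendsto (fun r : ℝ => f ![t, r * cos θ, r * sin θ]) (𝓝[>] (M + t))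
            (𝓝 (f ![t, (M + t) * cos θ, (M + t) * sin θ])) :=
            (hcl.tendsto (M + t)).mono_left nhdsWithin_le_nhds
          refine tendsto_nhds_unique h1 ?_
          refine tendsto_const_nhds.congr' ?_
          filter_upwards [self_mem_nhdsWithin] with r hr
          exact (hz θ r hr).symm
      · rw [Measure.prod_restrict, ← Measure.volume_eq_prod]
        exact wp_int _ _ (by fun_prop)
    · exact wp_int _ _ (by fun_prop)
    · exact wp_int _ _ (by fun_prop)
  · rintro ⟨r, θ⟩ hp
    have hr : 0 < r := by
      rw [polarCoord_target] at hp
      exact hp.1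
    simp only [polarCoord_symm_apply, smul_eq_mul, hsqrt r θ hr, hDdef]
    field_simp
  · intro p hp
    simp [hDz _ _ hp]
  · rintro ⟨r, θ⟩ hp
    have hr : 0 < r := by
      rw [polarCoord_target] at hp
      exact hp.1
    simp only [polarCoord_symm_apply, smul_eq_mul, hsqrt r θ hr]
  · intro p hp
    simp [hz _ _ hp]
end
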